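/- arXiv:1701.02397 — 3 statements merged into one kernel-verified Lean document; each statement's English description precedes it below -/
import Mathlib

section
/- Let p ∈ (0,1), q = 1 − p, and let (S_n, K_n)_{n≥0} be a random trie pair family with parameter p. Set μ(n) = E(S_n), ν(n) = E(K_n), w(n) = E(S_n K_n), and define the entire functions f̃₁₀(z) = e^{−z} Σ_{n≥0} μ(n) zⁿ/n!, f̃₀₁(z) = e^{−z} Σ_{n≥0} ν(n) zⁿ/n!, and f̃₁₁(z) = e^{−z} Σ_{n≥0} w(n) zⁿ/n!. Then for all z ∈ ℂ: f̃₁₁(z) = f̃₁₁(pz) + f̃₁₁(qz) + f̃₁₀(pz)(f̃₀₁(qz) + z) + f̃₁₀(qz)(f̃₀₁(pz) + z) + p z f̃₁₀′(pz) + q z f̃₁₀′(qz) + f̃₀₁(pz) + f̃₀₁(qz) + z(1 − e^{−z}). -/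
open MeasureTheory ProbabilityTheory Filter Topology

noncomputable def binomialMeasure (n : ℕ) (p : ℝ) : Measure ℕ :=
  ∑ k ∈ Finset.range (n + 1),
    (ENNReal.ofReal ((n.choose k : ℝ) * p ^ k * (1 - p) ^ (n - k))) • Measure.dirac k

/-- The combination map `(B, (S',K')_j, (S'',K'')_j) ↦ (S'_B + S''_{n-B} + 1, K'_B + K''_{n-B} + n)`. -/
def trieStep (n : ℕ) (ω : ℕ × ((ℕ → ℕ × ℕ) × (ℕ → ℕ × ℕ))) : ℕ × ℕ :=
  ((ω.2.1 ω.1).1 + (ω.2.2 (n - ω.1)).1 + 1,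
   (ω.2.1 ω.1).2 + (ω.2.2 (n - ω.1)).2 + n)

/-- A random trie pair family with parameter `p`, given by the joint laws
`μ n` of `(S_n, K_n)` on `ℕ × ℕ`. -/
structure IsTriePairFamily (p : ℝ) (μ : ℕ → Measure (ℕ × ℕ)) : Prop where
  prob : ∀ n, IsProbabilityMeasure (μ n)
  moments : ∀ n r : ℕ, Integrable (fun x : ℕ × ℕ => ((x.1 : ℝ) + (x.2 : ℝ)) ^ r) (μ n)
  init0 : μ 0 = Measure.dirac (0, 0)
  init1 : μ 1 = Measure.dirac (0, 0)
  recur : ∀ n, 2 ≤ n → ∃ P : Measure (ℕ × ((ℕ → ℕ × ℕ) × (ℕ → ℕ × ℕ))),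
    IsProbabilityMeasure P ∧
    P.map Prod.fst = binomialMeasure n p ∧
    (∀ j, P.map (fun ω => ω.2.1 j) = μ j) ∧
    (∀ j, P.map (fun ω => ω.2.2 j) = μ j) ∧
    P = (P.map Prod.fst).prod
          ((P.map (fun ω => ω.2.1)).prod (P.map (fun ω => ω.2.2))) ∧
    μ n = P.map (trieStep n)

noncomputable def eS (μ : ℕ → Measure (ℕ × ℕ)) (n : ℕ) : ℝ := ∫ x, (x.1 : ℝ) ∂ μ n

noncomputable def eK (μ : ℕ → Measure (ℕ × ℕ)) (n : ℕ) : ℝ := ∫ x, (x.2 : ℝ) ∂ μ n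

noncomputable def varS (μ : ℕ → Measure (ℕ × ℕ)) (n : ℕ) : ℝ :=
  ∫ x, ((x.1 : ℝ) - eS μ n) ^ 2 ∂ μ n

noncomputable def varK (μ : ℕ → Measure (ℕ × ℕ)) (n : ℕ) : ℝ :=
  ∫ x, ((x.2 : ℝ) - eK μ n) ^ 2 ∂ μ n

noncomputable def covSK (μ : ℕ → Measure (ℕ × ℕ)) (n : ℕ) : ℝ :=
  ∫ x, ((x.1 : ℝ) - eS μ n) * ((x.2 : ℝ) - eK μ n) ∂ μ n

noncomputable def eSK (μ : ℕ → Measure (ℕ × ℕ)) (n : ℕ) : ℝ :=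
  ∫ x, (x.1 : ℝ) * (x.2 : ℝ) ∂ μ n

/-- Poisson generating function of `E(S_n)`. -/
noncomputable def pgfS (μ : ℕ → Measure (ℕ × ℕ)) (z : ℂ) : ℂ :=
  Complex.exp (-z) * ∑' n : ℕ, (eS μ n : ℂ) * z ^ n / (n.factorial : ℂ)

/-- Poisson generating function of `E(K_n)`. -/
noncomputable def pgfK (μ : ℕ → Measure (ℕ × ℕ)) (z : ℂ) : ℂ :=
  Complex.exp (-z) * ∑' n : ℕ, (eK μ n : ℂ) * z ^ n / (n.factorial : ℂ)

/-- Poisson generating function of `E(S_n K_n)`. -/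
noncomputable def pgfSK (μ : ℕ → Measure (ℕ × ℕ)) (z : ℂ) : ℂ :=
  Complex.exp (-z) * ∑' n : ℕ, (eSK μ n : ℂ) * z ^ n / (n.factorial : ℂ)

/-- The binomial convolution `n ↦ ∑ k, C(n,k) p^k q^(n-k) a k b (n-k)`. -/
noncomputable def binConv (p q : ℝ) (a b : ℕ → ℝ) (n : ℕ) : ℝ :=
  ∑ k ∈ Finset.range (n + 1), (n.choose k : ℝ) * p ^ k * q ^ (n - k) * (a k * b (n - k))

/-- The exponential generating function of a real sequence. -/
noncomputable def expGenFun (a : ℕ → ℝ) (z : ℂ) : ℂ :=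
  ∑' n : ℕ, (a n : ℂ) * z ^ n / (n.factorial : ℂ)

/-- A sequence growing at most geometrically. -/
def GeoBdd (a : ℕ → ℝ) : Prop :=
  ∃ C R : ℝ, 0 ≤ C ∧ 1 ≤ R ∧ ∀ n, |a n| ≤ C * R ^ n

section GeoBdd

variable {a b : ℕ → ℝ}

lemma GeoBdd.add (ha : GeoBdd a) (hb : GeoBdd b) : GeoBdd (fun n => a n + b n) := by
  obtain ⟨C, R, hC, hR, h⟩ := ha
  obtain ⟨D, T, hD, hT, h'⟩ := hb
  refine ⟨C + D, max R T, by positivity, le_max_of_le_left hR, fun n => ?_⟩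
  have h1 : R ^ n ≤ max R T ^ n := pow_le_pow_left₀ (by linarith) (le_max_left _ _) n
  have h2 : T ^ n ≤ max R T ^ n := pow_le_pow_left₀ (by linarith) (le_max_right _ _) n
  calc |a n + b n| ≤ |a n| + |b n| := abs_add_le _ _
    _ ≤ C * R ^ n + D * T ^ n := add_le_add (h n) (h' n)
    _ ≤ C * max R T ^ n + D * max R T ^ n := by gcongr
    _ = _ := by ring

lemma GeoBdd.mul (ha : GeoBdd a) (hb : GeoBdd b) : GeoBdd (fun n => a n * b n) := by
  obtain ⟨C, R, hC, hR, h⟩ := ha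
  obtain ⟨D, T, hD, hT, h'⟩ := hb
  refine ⟨C * D, R * T, by positivity, by nlinarith, fun n => ?_⟩
  calc |a n * b n| = |a n| * |b n| := abs_mul _ _
    _ ≤ (C * R ^ n) * (D * T ^ n) := by gcongr; exacts [h n, h' n]
    _ = _ := by rw [mul_pow]; ring

lemma GeoBdd.const (c : ℝ) : GeoBdd (fun _ => c) :=
  ⟨|c|, 1, abs_nonneg _, le_rfl, fun n => by simp⟩

lemma GeoBdd.natCast : GeoBdd (fun n => (n : ℝ)) :=
  ⟨1, 2, zero_le_one, one_le_two, fun n => by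
    rw [abs_of_nonneg (Nat.cast_nonneg n), one_mul]
    change (n : ℝ) ≤ 2 ^ n
    exact_mod_cast (Nat.lt_two_pow_self (n := n)).le⟩

lemma sum_binomial_weights {p q : ℝ} (hpq : p + q = 1) (n : ℕ) :
    ∑ k ∈ Finset.range (n + 1), (n.choose k : ℝ) * p ^ k * q ^ (n - k) = 1 := by
  have h := add_pow p q n
  rw [hpq, one_pow] at h
  rw [h]
  exact Finset.sum_congr rfl fun k _ => by ring

lemma GeoBdd.binConv {p q : ℝ} (hp : 0 ≤ p) (hq : 0 ≤ q) (hpq : p + q = 1)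
    (ha : GeoBdd a) (hb : GeoBdd b) : GeoBdd (binConv p q a b) := by
  obtain ⟨C, R, hC, hR, h⟩ := ha
  obtain ⟨D, T, hD, hT, h'⟩ := hb
  refine ⟨C * D, R * T, by positivity, by nlinarith, fun n => ?_⟩
  unfold _root_.binConv
  calc _ ≤ ∑ k ∈ Finset.range (n + 1),
        (n.choose k : ℝ) * p ^ k * q ^ (n - k) * (C * D * (R * T) ^ n) := by
        refine (Finset.abs_sum_le_sum_abs _ _).trans (Finset.sum_le_sum fun k hk => ?_)
        have hk : k ≤ n := Nat.lt_succ_iff.mp (Finset.mem_range.mp hk)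
        rw [abs_mul, abs_of_nonneg (by positivity), abs_mul]
        refine mul_le_mul_of_nonneg_left ?_ (by positivity)
        calc |a k| * |b (n - k)| ≤ (C * R ^ k) * (D * T ^ (n - k)) := by
              gcongr; exacts [h k, h' _]
          _ ≤ (C * R ^ n) * (D * T ^ n) := by
              gcongr
              exact Nat.sub_le n k
          _ = _ := by rw [mul_pow]; ring
    _ = _ := by rw [← Finset.sum_mul, sum_binomial_weights hpq, one_mul]

end GeoBdd

lemma binConv_comm (p q : ℝ) (a b : ℕ → ℝ) (n : ℕ) :
    binConv p q a b n = binConv q p b a n := by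
  unfold binConv
  rw [← Finset.sum_range_reflect]
  refine Finset.sum_congr rfl fun k hk => ?_
  have hk : k ≤ n := Nat.lt_succ_iff.mp (Finset.mem_range.mp hk)
  have h1 : n + 1 - 1 - k = n - k := by omega
  rw [h1, Nat.choose_symm hk, Nat.sub_sub_self hk]
  ring

lemma binConv_one_le {p q : ℝ} (hp : 0 ≤ p) (hq : 0 ≤ q) (hpq : p + q = 1) {a : ℕ → ℝ}
    {n : ℕ} {M : ℝ} (hM : 0 ≤ M) (h : ∀ k < n, a k ≤ M) :
    binConv p q a (fun _ => 1) n ≤ p ^ n * a n + M := by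
  unfold binConv
  have h1 := sum_binomial_weights hpq n
  rw [Finset.sum_range_succ] at h1 ⊢
  have h2 : ∑ k ∈ Finset.range n, (n.choose k : ℝ) * p ^ k * q ^ (n - k) * (a k * 1) ≤
      (∑ k ∈ Finset.range n, (n.choose k : ℝ) * p ^ k * q ^ (n - k)) * M := by
    rw [Finset.sum_mul]
    refine Finset.sum_le_sum fun k hk => ?_
    rw [mul_one]
    have := h k (Finset.mem_range.mp hk)
    gcongr
  have h3 : 0 ≤ p ^ n := by positivity
  simp only [Nat.choose_self, Nat.cast_one, one_mul, Nat.sub_self, pow_zero, mul_one] at h1 ⊢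
  have h4 : ∑ k ∈ Finset.range n, (n.choose k : ℝ) * p ^ k * q ^ (n - k) ≤ 1 := by linarith
  simp only [mul_one] at h2
  nlinarith [mul_le_mul_of_nonneg_right h4 hM]

lemma geoBdd_of_recurrence {p q : ℝ} (hp : 0 < p) (hq : 0 < q) (hpq : p + q = 1)
    {a t : ℕ → ℝ} (ha : ∀ n, 0 ≤ a n) (ha0 : a 0 = 0) (ha1 : a 1 = 0)
    (hrec : ∀ n, 2 ≤ n →
      a n = binConv p q a (fun _ => 1) n + binConv p q (fun _ => 1) a n + t n)
    (ht : GeoBdd t) : GeoBdd a := by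
  obtain ⟨D, r, hD, hr, hb⟩ := ht
  set d : ℝ := 2 * p * q with hd
  have hd0 : 0 < d := by positivity
  set R : ℝ := max r (4 / d)
  have hR : 1 ≤ R := le_max_of_le_left hr
  have hR4 : 4 ≤ d * R := by
    have : 4 / d ≤ R := le_max_right _ _
    rw [div_le_iff₀ hd0] at this
    linarith
  set C : ℝ := 2 * D / d
  have hC : 0 ≤ C := by positivity
  have hdC : d * C = 2 * D := by simp only [C]; field_simp
  refine ⟨C, R, hC, hR, fun n => ?_⟩
  rw [abs_of_nonneg (ha n)]
  induction n using Nat.strong_induction_on with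
  | _ n ih =>
    rcases Nat.lt_or_ge n 2 with hn | hn
    · have : a n = 0 := by interval_cases n <;> assumption
      rw [this]
      positivity
    · obtain ⟨m, rfl⟩ : ∃ m, n = m + 1 := ⟨n - 1, by omega⟩
      have hM : ∀ k < m + 1, a k ≤ C * R ^ m := fun k hk => (ih k hk).trans (by
        gcongr
        omega)
      have hM0 : 0 ≤ C * R ^ m := by positivity
      have e := hrec _ hn
      rw [binConv_comm p q (fun _ => 1)] at e
      have e1 := binConv_one_le hp.le hq.le hpq hM0 hM
      have e2 := binConv_one_le hq.le hp.le (by linarith) hM0 hM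
      have e3 : p ^ (m + 1) ≤ p ^ 2 := pow_le_pow_of_le_one hp.le (by linarith) hn
      have e4 : q ^ (m + 1) ≤ q ^ 2 := pow_le_pow_of_le_one hq.le (by linarith) hn
      have e5 : t (m + 1) ≤ D * R ^ (m + 1) := (le_abs_self _).trans <| (hb _).trans <| by
        gcongr
        exact le_max_left _ _
      have e6 : p ^ 2 + q ^ 2 = 1 - d := by
        rw [hd, ← one_pow 2, ← hpq]; ring
      have e7 : d * a (m + 1) ≤ 2 * (C * R ^ m) + D * R ^ (m + 1) := by
        nlinarith [mul_le_mul_of_nonneg_right e3 (ha (m + 1)),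
          mul_le_mul_of_nonneg_right e4 (ha (m + 1)), congrArg (· * a (m + 1)) e6]
      refine le_of_mul_le_mul_left (e7.trans ?_) hd0
      have e8 := mul_le_mul_of_nonneg_right hR4 hM0
      have e9 : d * (C * R ^ (m + 1)) = d * R * (C * R ^ m) := by ring
      have e10 : d * (C * R ^ (m + 1)) = 2 * (D * R ^ (m + 1)) := by
        rw [← mul_assoc, hdC]; ring
      linarith

section ExpGenFun

variable {a b : ℕ → ℝ}

lemma GeoBdd.exists_summable_bound (ha : GeoBdd a) (r : ℝ) :
    ∃ u : ℕ → ℝ, Summable u ∧ ∀ z : ℂ, ‖z‖ ≤ r → ∀ n,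
      ‖(a n : ℂ) * z ^ n / (n.factorial : ℂ)‖ ≤ u n := by
  obtain ⟨C, R, hC, hR, h⟩ := ha
  refine ⟨fun n => C * ((R * r) ^ n / n.factorial),
    (Real.summable_pow_div_factorial _).mul_left C, fun z hz n => ?_⟩
  rw [norm_div, norm_mul, norm_pow, Complex.norm_real, Complex.norm_natCast, Real.norm_eq_abs,
    mul_div_assoc]
  calc |a n| * (‖z‖ ^ n / n.factorial) ≤ C * R ^ n * (r ^ n / n.factorial) := by
        gcongr
        exact h n
    _ = C * ((R * r) ^ n / n.factorial) := by rw [mul_pow]; ring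

lemma GeoBdd.summable_norm (ha : GeoBdd a) (z : ℂ) :
    Summable fun n : ℕ => ‖(a n : ℂ) * z ^ n / (n.factorial : ℂ)‖ := by
  obtain ⟨u, hu, h⟩ := ha.exists_summable_bound ‖z‖
  exact Summable.of_nonneg_of_le (fun _ => norm_nonneg _) (h z le_rfl) hu

lemma GeoBdd.hasSum (ha : GeoBdd a) (z : ℂ) :
    HasSum (fun n : ℕ => (a n : ℂ) * z ^ n / (n.factorial : ℂ)) (expGenFun a z) :=
  (ha.summable_norm z).of_norm.hasSum

lemma hasSum_binConv (p q : ℝ) (ha : GeoBdd a) (hb : GeoBdd b) (z : ℂ) :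
    HasSum (fun n : ℕ => (binConv p q a b n : ℂ) * z ^ n / (n.factorial : ℂ))
      (expGenFun a (p * z) * expGenFun b (q * z)) := by
  have h := hasSum_sum_range_mul_of_summable_norm (ha.summable_norm (p * z))
    (hb.summable_norm (q * z))
  refine (congrArg (HasSum · _) (funext fun n => ?_)).mpr h
  simp only [binConv]
  push_cast
  rw [Finset.sum_mul, Finset.sum_div]
  refine Finset.sum_congr rfl fun k hk => ?_
  have hk : k ≤ n := Nat.lt_succ_iff.mp (Finset.mem_range.mp hk)
  have e : z ^ n = z ^ k * z ^ (n - k) := by rw [← pow_add, Nat.add_sub_cancel' hk]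
  rw [Nat.cast_choose ℂ hk, e, mul_pow, mul_pow]
  have h1 : (n.factorial : ℂ) ≠ 0 := by exact_mod_cast n.factorial_ne_zero
  have h2 : (k.factorial : ℂ) ≠ 0 := by exact_mod_cast k.factorial_ne_zero
  have h3 : ((n - k).factorial : ℂ) ≠ 0 := by exact_mod_cast (n - k).factorial_ne_zero
  field_simp

lemma expGenFun_one (z : ℂ) : expGenFun (fun _ => 1) z = Complex.exp z := by
  rw [Complex.exp_eq_exp_ℂ, NormedSpace.exp_eq_tsum_div]
  simp [expGenFun]

lemma differentiable_expGenFun (ha : GeoBdd a) : Differentiable ℂ (expGenFun a) := by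
  intro z
  obtain ⟨u, hu, h⟩ := ha.exists_summable_bound (‖z‖ + 1)
  have hz : z ∈ Metric.ball (0 : ℂ) (‖z‖ + 1) := by simp
  exact (Complex.differentiableOn_tsum_of_summable_norm hu (fun n => by fun_prop)
    Metric.isOpen_ball (fun n w hw => h w (by simpa using (mem_ball_zero_iff.mp hw).le) n)
    ).differentiableAt (Metric.isOpen_ball.mem_nhds hz)

lemma expGenFun_natCast_mul (ha : GeoBdd a) (z : ℂ) :
    expGenFun (fun n => n * a n) z = z * deriv (expGenFun a) z := by
  obtain ⟨u, hu, h⟩ := ha.exists_summable_bound (‖z‖ + 1)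
  have hz : z ∈ Metric.ball (0 : ℂ) (‖z‖ + 1) := by simp
  have hs := Complex.hasSum_deriv_of_summable_norm hu
    (fun n => (by fun_prop : DifferentiableOn ℂ
      (fun z : ℂ => (a n : ℂ) * z ^ n / (n.factorial : ℂ)) (Metric.ball 0 (‖z‖ + 1))))
    Metric.isOpen_ball (fun n w hw => h w (by simpa using (mem_ball_zero_iff.mp hw).le) n) hz
  refine HasSum.tsum_eq (L := .unconditional ℕ) ?_
  refine (congrArg (HasSum · _) (funext fun n => ?_)).mpr (hs.mul_left z)
  simp only [deriv_div_const, deriv_const_mul_field, deriv_pow_field]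
  rcases n with _ | n
  · simp
  · push_cast
    rw [pow_succ]
    ring

lemma expGenFun_natCast (z : ℂ) : expGenFun (fun n => n) z = z * Complex.exp z := by
  have h := expGenFun_natCast_mul (GeoBdd.const 1) z
  rw [funext expGenFun_one, Complex.deriv_exp] at h
  simpa using h

end ExpGenFun

section Law

variable {p : ℝ} {μ : ℕ → Measure (ℕ × ℕ)}

lemma measurable_trieStep (n : ℕ) : Measurable (trieStep n) := by
  refine measurable_from_prod_countable_right fun k => ?_
  change Measurable fun y : (ℕ → ℕ × ℕ) × (ℕ → ℕ × ℕ) =>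
    ((y.1 k).1 + (y.2 (n - k)).1 + 1, (y.1 k).2 + (y.2 (n - k)).2 + n)
  fun_prop

lemma IsTriePairFamily.law_eq (hμ : IsTriePairFamily p μ) {n : ℕ} (hn : 2 ≤ n) :
    μ n = ∑ k ∈ Finset.range (n + 1),
      (ENNReal.ofReal ((n.choose k : ℝ) * p ^ k * (1 - p) ^ (n - k))) •
        ((μ k).prod (μ (n - k))).map
          (fun x => (x.1.1 + x.2.1 + 1, x.1.2 + x.2.2 + n)) := by
  obtain ⟨P, hP, hB, h1, h2, hind, hn⟩ := hμ.recur n hn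
  set Q₁ := P.map (fun ω => ω.2.1) with hQ₁
  set Q₂ := P.map (fun ω => ω.2.2) with hQ₂
  have hp₁ : IsProbabilityMeasure Q₁ := Measure.isProbabilityMeasure_map (by fun_prop)
  have hp₂ : IsProbabilityMeasure Q₂ := Measure.isProbabilityMeasure_map (by fun_prop)
  have h1' : ∀ j, Q₁.map (fun f => f j) = μ j := fun j => by
    rw [hQ₁, Measure.map_map (by fun_prop) (by fun_prop), ← h1 j]; rfl
  have h2' : ∀ j, Q₂.map (fun f => f j) = μ j := fun j => by
    rw [hQ₂, Measure.map_map (by fun_prop) (by fun_prop), ← h2 j]; rfl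
  clear_value Q₁ Q₂
  rw [hn, hind, hB]
  ext s hs
  rw [Measure.map_apply (measurable_trieStep n) hs,
    Measure.prod_apply (measurable_trieStep n hs), binomialMeasure,
    lintegral_finsetSum_measure, Measure.finsetSum_apply]
  refine Finset.sum_congr rfl fun k _ => ?_
  rw [lintegral_smul_measure, lintegral_dirac, Measure.smul_apply, ← h1' k, ← h2' (n - k),
    Measure.map_prod_map _ _ (by fun_prop) (by fun_prop),
    Measure.map_map (by fun_prop) (by fun_prop), Measure.map_apply (by fun_prop) hs]
  rfl

lemma IsTriePairFamily.integral_eq (hμ : IsTriePairFamily p μ) (hp0 : 0 < p) (hp1 : p < 1)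
    {n : ℕ} (hn : 2 ≤ n)
    {g : ℕ × ℕ → ℝ} {v : ℕ → ℝ}
    (hg : ∀ k, Integrable (fun x : (ℕ × ℕ) × (ℕ × ℕ) =>
      g (x.1.1 + x.2.1 + 1, x.1.2 + x.2.2 + n)) ((μ k).prod (μ (n - k))))
    (hv : ∀ k, ∫ x : (ℕ × ℕ) × (ℕ × ℕ),
      g (x.1.1 + x.2.1 + 1, x.1.2 + x.2.2 + n) ∂((μ k).prod (μ (n - k))) = v k) :
    ∫ x, g x ∂(μ n) = ∑ k ∈ Finset.range (n + 1),
      (n.choose k : ℝ) * p ^ k * (1 - p) ^ (n - k) * v k := by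
  have hm : Measurable (fun x : (ℕ × ℕ) × (ℕ × ℕ) => (x.1.1 + x.2.1 + 1, x.1.2 + x.2.2 + n)) := by
    fun_prop
  have hgm : ∀ m : Measure (ℕ × ℕ), AEStronglyMeasurable g m := fun m =>
    (measurable_of_countable g).aestronglyMeasurable
  have hq : 0 ≤ 1 - p := by linarith
  rw [hμ.law_eq hn, integral_finsetSum_measure]
  · refine Finset.sum_congr rfl fun k _ => ?_
    rw [integral_smul_measure, integral_map hm.aemeasurable (hgm _), hv,
      ENNReal.toReal_ofReal (by positivity), smul_eq_mul]
  · intro k _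
    exact ((integrable_map_measure (hgm _) hm.aemeasurable).mpr (hg k)).smul_measure
      ENNReal.ofReal_ne_top

lemma IsTriePairFamily.integrable_of_le (hμ : IsTriePairFamily p μ) (n r : ℕ)
    {g : ℕ × ℕ → ℝ} (hg : ∀ x, |g x| ≤ ((x.1 : ℝ) + (x.2 : ℝ)) ^ r) : Integrable g (μ n) :=
  (hμ.moments n r).mono' (measurable_of_countable g).aestronglyMeasurable
    (Eventually.of_forall hg)

lemma IsTriePairFamily.integrable_fst (hμ : IsTriePairFamily p μ) (n : ℕ) :
    Integrable (fun x : ℕ × ℕ => (x.1 : ℝ)) (μ n) :=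
  hμ.integrable_of_le n 1 fun x => by
    rw [abs_of_nonneg (by positivity), pow_one]
    exact le_add_of_nonneg_right (by positivity)

lemma IsTriePairFamily.integrable_snd (hμ : IsTriePairFamily p μ) (n : ℕ) :
    Integrable (fun x : ℕ × ℕ => (x.2 : ℝ)) (μ n) :=
  hμ.integrable_of_le n 1 fun x => by
    rw [abs_of_nonneg (by positivity), pow_one]
    exact le_add_of_nonneg_left (by positivity)

lemma IsTriePairFamily.integrable_fst_mul_snd (hμ : IsTriePairFamily p μ) (n : ℕ) :
    Integrable (fun x : ℕ × ℕ => (x.1 : ℝ) * (x.2 : ℝ)) (μ n) :=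
  hμ.integrable_of_le n 2 fun x => by
    rw [abs_of_nonneg (by positivity)]
    nlinarith [sq_nonneg (x.1 : ℝ), sq_nonneg (x.2 : ℝ),
      mul_nonneg (Nat.cast_nonneg (α := ℝ) x.1) (Nat.cast_nonneg (α := ℝ) x.2)]

/-- `f` is integrable with integral `v`. -/
def HasIntegralValue {α : Type*} [MeasurableSpace α] (m : Measure α) (f : α → ℝ) (v : ℝ) : Prop :=
  Integrable f m ∧ ∫ x, f x ∂m = v

lemma HasIntegralValue.add {α : Type*} [MeasurableSpace α] {m : Measure α} {f g : α → ℝ}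
    {v w : ℝ} (hf : HasIntegralValue m f v) (hg : HasIntegralValue m g w) :
    HasIntegralValue m (fun x => f x + g x) (v + w) :=
  ⟨hf.1.add hg.1, by rw [integral_add hf.1 hg.1, hf.2, hg.2]⟩

lemma HasIntegralValue.mul_prod {α β : Type*} [MeasurableSpace α] [MeasurableSpace β]
    {m : Measure α} {m' : Measure β} [SFinite m] [SFinite m'] {f : α → ℝ} {g : β → ℝ}
    {v w : ℝ} (hf : HasIntegralValue m f v) (hg : HasIntegralValue m' g w) :
    HasIntegralValue (m.prod m') (fun x => f x.1 * g x.2) (v * w) :=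
  ⟨hf.1.mul_prod hg.1, by rw [integral_prod_mul, hf.2, hg.2]⟩

lemma hasIntegralValue_const {α : Type*} [MeasurableSpace α] {m : Measure α}
    [IsProbabilityMeasure m] (c : ℝ) : HasIntegralValue m (fun _ => c) c :=
  ⟨integrable_const c, by simp⟩

lemma IsTriePairFamily.eS_recurrence (hμ : IsTriePairFamily p μ) (hp0 : 0 < p) (hp1 : p < 1)
    {n : ℕ} (hn : 2 ≤ n) :
    eS μ n = binConv p (1 - p) (eS μ) (fun _ => 1) n
      + binConv p (1 - p) (fun _ => 1) (eS μ) n + 1 := by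
  have hP := hμ.prob
  have key : ∀ k, HasIntegralValue ((μ k).prod (μ (n - k)))
      (fun x => ((x.1.1 + x.2.1 + 1 : ℕ) : ℝ)) (eS μ k * 1 + 1 * eS μ (n - k) + 1) := fun k => by
    have hS : ∀ j, HasIntegralValue (μ j) (fun x => (x.1 : ℝ)) (eS μ j) := fun j =>
      ⟨hμ.integrable_fst j, rfl⟩
    convert (((hS k).mul_prod (hasIntegralValue_const (m := μ (n - k)) 1)).add
      ((hasIntegralValue_const (m := μ k) 1).mul_prod (hS (n - k)))).add
      (hasIntegralValue_const 1) using 2 with x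
    push_cast
    ring
  have h := hμ.integral_eq hp0 hp1 hn (g := fun x => (x.1 : ℝ)) (fun k => (key k).1)
    (fun k => (key k).2)
  rw [eS, h]
  simp only [mul_add, Finset.sum_add_distrib, mul_one (_ * _ ^ (n - _)),
    sum_binomial_weights (show p + (1 - p) = 1 by ring) n]
  rfl

lemma IsTriePairFamily.eK_recurrence (hμ : IsTriePairFamily p μ) (hp0 : 0 < p) (hp1 : p < 1)
    {n : ℕ} (hn : 2 ≤ n) :
    eK μ n = binConv p (1 - p) (eK μ) (fun _ => 1) n
      + binConv p (1 - p) (fun _ => 1) (eK μ) n + n := by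
  have hP := hμ.prob
  have key : ∀ k, HasIntegralValue ((μ k).prod (μ (n - k)))
      (fun x => ((x.1.2 + x.2.2 + n : ℕ) : ℝ)) (eK μ k * 1 + 1 * eK μ (n - k) + n) := fun k => by
    have hK : ∀ j, HasIntegralValue (μ j) (fun x => (x.2 : ℝ)) (eK μ j) := fun j =>
      ⟨hμ.integrable_snd j, rfl⟩
    convert (((hK k).mul_prod (hasIntegralValue_const (m := μ (n - k)) 1)).add
      ((hasIntegralValue_const (m := μ k) 1).mul_prod (hK (n - k)))).add
      (hasIntegralValue_const n) using 2 with x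
    push_cast
    ring
  have h := hμ.integral_eq hp0 hp1 hn (g := fun x => (x.2 : ℝ)) (fun k => (key k).1)
    (fun k => (key k).2)
  rw [eK, h]
  simp only [mul_add, Finset.sum_add_distrib, ← Finset.sum_mul,
    sum_binomial_weights (show p + (1 - p) = 1 by ring) n, one_mul]
  simp only [binConv, one_mul]

/-- The inhomogeneous part of the recurrence for the mixed moments, apart from the toll `n`. -/
noncomputable def mixedToll (p : ℝ) (a b : ℕ → ℝ) (n : ℕ) : ℝ :=
  binConv p (1 - p) a b n + binConv p (1 - p) b a n
    + binConv p (1 - p) (fun k => k * a k) (fun _ => 1) n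
    + binConv p (1 - p) a (fun k => k) n
    + binConv p (1 - p) (fun k => k) a n
    + binConv p (1 - p) (fun _ => 1) (fun k => k * a k) n
    + binConv p (1 - p) b (fun _ => 1) n + binConv p (1 - p) (fun _ => 1) b n

lemma IsTriePairFamily.eSK_recurrence (hμ : IsTriePairFamily p μ) (hp0 : 0 < p) (hp1 : p < 1)
    {n : ℕ} (hn : 2 ≤ n) :
    eSK μ n = binConv p (1 - p) (eSK μ) (fun _ => 1) n
      + binConv p (1 - p) (fun _ => 1) (eSK μ) n + (mixedToll p (eS μ) (eK μ) n + n) := by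
  have hP := hμ.prob
  have hS : ∀ j, HasIntegralValue (μ j) (fun x => (x.1 : ℝ)) (eS μ j) := fun j =>
    ⟨hμ.integrable_fst j, rfl⟩
  have hK : ∀ j, HasIntegralValue (μ j) (fun x => (x.2 : ℝ)) (eK μ j) := fun j =>
    ⟨hμ.integrable_snd j, rfl⟩
  have hSK : ∀ j, HasIntegralValue (μ j) (fun x => (x.1 : ℝ) * (x.2 : ℝ)) (eSK μ j) := fun j =>
    ⟨hμ.integrable_fst_mul_snd j, rfl⟩
  have hc : ∀ (j : ℕ) (c : ℝ), HasIntegralValue (μ j) (fun _ => c) c := fun j c =>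
    hasIntegralValue_const c
  have key : ∀ k, HasIntegralValue ((μ k).prod (μ (n - k)))
      (fun x => ((x.1.1 + x.2.1 + 1 : ℕ) : ℝ) * ((x.1.2 + x.2.2 + n : ℕ) : ℝ))
      (eSK μ k * 1 + 1 * eSK μ (n - k) + eS μ k * eK μ (n - k) + eK μ k * eS μ (n - k)
        + eS μ k * n + n * eS μ (n - k) + eK μ k * 1 + 1 * eK μ (n - k) + 1 * n) := fun k => by
    convert (((((((((hSK k).mul_prod (hc (n - k) 1)).add
      ((hc k 1).mul_prod (hSK (n - k)))).add
      ((hS k).mul_prod (hK (n - k)))).add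
      ((hK k).mul_prod (hS (n - k)))).add
      ((hS k).mul_prod (hc (n - k) n))).add
      ((hc k n).mul_prod (hS (n - k)))).add
      ((hK k).mul_prod (hc (n - k) 1))).add
      ((hc k 1).mul_prod (hK (n - k)))).add
      ((hc k 1).mul_prod (hc (n - k) n)) using 2 with x
    push_cast
    ring
  have h := hμ.integral_eq hp0 hp1 hn (g := fun x => (x.1 : ℝ) * (x.2 : ℝ))
    (fun k => (key k).1) (fun k => (key k).2)
  have e : ∑ k ∈ Finset.range (n + 1), (n.choose k : ℝ) * p ^ k * (1 - p) ^ (n - k) * (n : ℝ)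
      = n := by
    rw [← Finset.sum_mul, sum_binomial_weights (by ring), one_mul]
  rw [eSK, h]
  refine Eq.trans ?_ (congrArg (fun x => binConv p (1 - p) (eSK μ) (fun _ => 1) n
    + binConv p (1 - p) (fun _ => 1) (eSK μ) n + (mixedToll p (eS μ) (eK μ) n + x)) e)
  simp only [mixedToll, binConv, ← Finset.sum_add_distrib]
  refine Finset.sum_congr rfl fun k hk => ?_
  rw [Nat.cast_sub (Nat.lt_succ_iff.mp (Finset.mem_range.mp hk))]
  ring

lemma IsTriePairFamily.moments_zero (hμ : IsTriePairFamily p μ) {n : ℕ} (hn : n < 2) :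
    eS μ n = 0 ∧ eK μ n = 0 ∧ eSK μ n = 0 := by
  have : μ n = Measure.dirac (0, 0) := by
    interval_cases n
    exacts [hμ.init0, hμ.init1]
  simp [eS, eK, eSK, this]

lemma IsTriePairFamily.geoBdd_eS (hμ : IsTriePairFamily p μ) (hp0 : 0 < p) (hp1 : p < 1) :
    GeoBdd (eS μ) :=
  geoBdd_of_recurrence hp0 (sub_pos.mpr hp1) (by ring)
    (fun _ => integral_nonneg fun _ => by positivity)
    (hμ.moments_zero two_pos).1 (hμ.moments_zero one_lt_two).1
    (fun _ hn => hμ.eS_recurrence hp0 hp1 hn) (GeoBdd.const 1)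

lemma IsTriePairFamily.geoBdd_eK (hμ : IsTriePairFamily p μ) (hp0 : 0 < p) (hp1 : p < 1) :
    GeoBdd (eK μ) :=
  geoBdd_of_recurrence hp0 (sub_pos.mpr hp1) (by ring)
    (fun _ => integral_nonneg fun _ => by positivity)
    (hμ.moments_zero two_pos).2.1 (hμ.moments_zero one_lt_two).2.1
    (fun _ hn => hμ.eK_recurrence hp0 hp1 hn) GeoBdd.natCast

lemma GeoBdd.mixedToll {a b : ℕ → ℝ} (hp0 : 0 < p) (hp1 : p < 1) (ha : GeoBdd a)
    (hb : GeoBdd b) : GeoBdd (mixedToll p a b) := by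
  have hc : ∀ {a b : ℕ → ℝ}, GeoBdd a → GeoBdd b → GeoBdd (_root_.binConv p (1 - p) a b) :=
    fun ha hb => GeoBdd.binConv hp0.le (sub_pos.mpr hp1).le (by ring) ha hb
  have h1 := GeoBdd.const 1
  have hna := GeoBdd.natCast.mul ha
  exact (((((((hc ha hb).add (hc hb ha)).add (hc hna h1)).add (hc ha .natCast)).add
    (hc .natCast ha)).add (hc h1 hna)).add (hc hb h1)).add (hc h1 hb)

lemma IsTriePairFamily.geoBdd_eSK (hμ : IsTriePairFamily p μ) (hp0 : 0 < p) (hp1 : p < 1) :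
    GeoBdd (eSK μ) :=
  geoBdd_of_recurrence hp0 (sub_pos.mpr hp1) (by ring)
    (fun _ => integral_nonneg fun _ => by positivity)
    (hμ.moments_zero two_pos).2.2 (hμ.moments_zero one_lt_two).2.2
    (fun _ hn => hμ.eSK_recurrence hp0 hp1 hn)
    (((hμ.geoBdd_eS hp0 hp1).mixedToll hp0 hp1 (hμ.geoBdd_eK hp0 hp1)).add .natCast)

lemma IsTriePairFamily.eSK_eq (hμ : IsTriePairFamily p μ) (hp0 : 0 < p) (hp1 : p < 1) (n : ℕ) :
    eSK μ n = binConv p (1 - p) (eSK μ) (fun _ => 1) n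
      + binConv p (1 - p) (fun _ => 1) (eSK μ) n + mixedToll p (eS μ) (eK μ) n + n
      - if n = 1 then 1 else 0 := by
  rcases Nat.lt_or_ge n 2 with hn | hn
  · have h0 := hμ.moments_zero two_pos
    have h1 := hμ.moments_zero one_lt_two
    interval_cases n <;>
    simp [binConv, mixedToll, Finset.sum_range_succ, h0, h1]
  · rw [if_neg (by omega), hμ.eSK_recurrence hp0 hp1 hn]
    ring

lemma deriv_pgfS (hS : GeoBdd (eS μ)) (z : ℂ) :
    deriv (pgfS μ) z = Complex.exp (-z) * deriv (expGenFun (eS μ)) z - pgfS μ z := by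
  have h1 : HasDerivAt (fun z : ℂ => Complex.exp (-z)) (-Complex.exp (-z)) z := by
    simpa using (hasDerivAt_neg z).cexp
  have h := (h1.mul (differentiable_expGenFun hS z).hasDerivAt).deriv
  change deriv (pgfS μ) z = _ at h
  rw [h]
  change _ = _ - Complex.exp (-z) * expGenFun (eS μ) z
  ring

end Law

/-- functional equation for the Poisson generating function of `E(S_n K_n)`. -/
theorem stmt9 (p : ℝ) (hp0 : 0 < p) (hp1 : p < 1) (q : ℝ) (hq : q = 1 - p)
    (μ : ℕ → Measure (ℕ × ℕ)) (hμ : IsTriePairFamily p μ) :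
    ∀ z : ℂ,
      pgfSK μ z = pgfSK μ ((p : ℂ) * z) + pgfSK μ ((q : ℂ) * z)
        + pgfS μ ((p : ℂ) * z) * (pgfK μ ((q : ℂ) * z) + z)
        + pgfS μ ((q : ℂ) * z) * (pgfK μ ((p : ℂ) * z) + z)
        + (p : ℂ) * z * deriv (pgfS μ) ((p : ℂ) * z)
        + (q : ℂ) * z * deriv (pgfS μ) ((q : ℂ) * z)
        + pgfK μ ((p : ℂ) * z) + pgfK μ ((q : ℂ) * z)
        + z * (1 - Complex.exp (-z)) := by
  intro z
  subst hq
  have hS := hμ.geoBdd_eS hp0 hp1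
  have hK := hμ.geoBdd_eK hp0 hp1
  have hSK := hμ.geoBdd_eSK hp0 hp1
  have h1 := GeoBdd.const 1
  have hN := GeoBdd.natCast
  have hNS := hN.mul hS
  have hc := fun {a b : ℕ → ℝ} (ha : GeoBdd a) (hb : GeoBdd b) =>
    hasSum_binConv p (1 - p) ha hb z
  have hδ : HasSum (fun n : ℕ => ((if n = 1 then (1 : ℝ) else 0 : ℝ) : ℂ) * z ^ n /
      (n.factorial : ℂ)) z := by
    convert hasSum_ite_eq (1 : ℕ) z using 2 with n
    split_ifs with h <;> simp [h]
  have hsum := ((((hc hSK h1).add (hc h1 hSK)).add (((((((((hc hS hK).add (hc hK hS)).add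
    (hc hNS h1)).add (hc hS hN)).add (hc hN hS)).add (hc h1 hNS)).add (hc hK h1)).add
    (hc h1 hK)))).add (hN.hasSum z)).sub hδ
  have hE := hsum.tsum_eq
  rw [← tsum_congr (f := fun n : ℕ => (eSK μ n : ℂ) * z ^ n / (n.factorial : ℂ)) fun n => by
    rw [hμ.eSK_eq hp0 hp1 n, mixedToll]
    push_cast
    ring] at hE
  change expGenFun (eSK μ) z = _ at hE
  simp only [expGenFun_natCast_mul hS, expGenFun_natCast, expGenFun_one] at hE
  rw [deriv_pgfS hS, deriv_pgfS hS]
  change Complex.exp (-z) * expGenFun (eSK μ) z = _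
  rw [hE]
  simp only [show ∀ w, pgfS μ w = Complex.exp (-w) * expGenFun (eS μ) w from fun _ => rfl,
    show ∀ w, pgfK μ w = Complex.exp (-w) * expGenFun (eK μ) w from fun _ => rfl,
    show ∀ w, pgfSK μ w = Complex.exp (-w) * expGenFun (eSK μ) w from fun _ => rfl]
  set P := (p : ℂ) * z
  set Q := ((1 - p : ℝ) : ℂ) * z
  have hz : z = P + Q := by simp only [P, Q]; push_cast; ring
  have eP : Complex.exp P * Complex.exp (-P) = 1 := by rw [← Complex.exp_add]; simp
  have eQ : Complex.exp Q * Complex.exp (-Q) = 1 := by rw [← Complex.exp_add]; simp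
  have hz' : Complex.exp (-z) = Complex.exp (-P) * Complex.exp (-Q) := by
    rw [← Complex.exp_add, hz]; congr 1; ring
  have hz'' : Complex.exp z = Complex.exp P * Complex.exp Q := by
    rw [← Complex.exp_add, ← hz]
  rw [hz', hz'']
  clear_value P Q
  subst hz
  linear_combination
    (Complex.exp (-P) * (expGenFun (eSK μ) P + P * deriv (expGenFun (eS μ)) P
      + expGenFun (eS μ) P * Q + expGenFun (eK μ) P)) * eQ
    + (Complex.exp (-Q) * (expGenFun (eSK μ) Q + Q * deriv (expGenFun (eS μ)) Q
      + expGenFun (eS μ) Q * P + expGenFun (eK μ) Q)) * eP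
    + (P + Q) * (Complex.exp Q * Complex.exp (-Q) * eP + eQ)
end

section
/- Let p ∈ (0,1), q = 1 − p, and let (S_n, K_n)_{n≥0} be a random trie pair family with parameter p, with Poisson generating functions f̃₁₀, f̃₀₁, f̃₁₁ of E(S_n), E(K_n), E(S_n K_n) respectively. Define the Poissonized covariance C̃(z) = f̃₁₁(z) − f̃₁₀(z) f̃₀₁(z) − z f̃₁₀′(z) f̃₀₁′(z), and set h̃₁(z) = p q z (f̃₁₀′(pz) − f̃₁₀′(qz))(f̃₀₁′(pz) − f̃₀₁′(qz)) and h̃₂(z) = z e^{−z}( f̃₁₀(pz) + f̃₁₀(qz) + p(1 − z) f̃₁₀′(pz) + q(1 − z) f̃₁₀′(qz) ) + e^{−z}( (1 + z) f̃₀₁(pz) + (1 + z) f̃₀₁(qz) − p z² f̃₀₁′(pz) − q z² f̃₀₁′(qz) ) + z e^{−z}(1 − (1 + z²) e^{−z}). Then for all z ∈ ℂ: C̃(z) = C̃(pz) + C̃(qz) + h̃₁(z) + h̃₂(z). -/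
open MeasureTheory ProbabilityTheory Filter Topology

/-- Binomial convolution `∑ⱼ (n choose j) pʲ qⁿ⁻ʲ aⱼ cₙ₋ⱼ`. -/
noncomputable def binomConv (p q : ℝ) (a c : ℕ → ℝ) (n : ℕ) : ℝ :=
  ∑ j ∈ Finset.range (n + 1), (n.choose j : ℝ) * p ^ j * q ^ (n - j) * (a j * c (n - j))

/-- Exponential generating function. -/
noncomputable def egf (a : ℕ → ℝ) (z : ℂ) : ℂ :=
  ∑' n : ℕ, (a n : ℂ) * z ^ n / (n.factorial : ℂ)

/-- `a` grows at most exponentially; the base may be taken to be at least `4`. -/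
def ExpBounded (a : ℕ → ℝ) : Prop :=
  ∃ C R : ℝ, 0 ≤ C ∧ 4 ≤ R ∧ ∀ n, |a n| ≤ C * R ^ n

namespace ExpBounded

variable {a c : ℕ → ℝ}

lemma of_abs_le_one (h : ∀ n, |a n| ≤ 1) : ExpBounded a :=
  ⟨1, 4, by norm_num, le_rfl, fun n => (h n).trans (by
    rw [one_mul]; exact one_le_pow₀ (by norm_num))⟩

lemma natCast : ExpBounded fun n => (n : ℝ) :=
  ⟨1, 4, by norm_num, le_rfl, fun n => by
    rw [one_mul, Nat.abs_cast]
    exact_mod_cast (Nat.lt_pow_self (by norm_num : 1 < 4)).le⟩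

lemma mul (ha : ExpBounded a) (hc : ExpBounded c) : ExpBounded fun n => a n * c n := by
  obtain ⟨C, R, hC, hR, h⟩ := ha
  obtain ⟨C', R', hC', hR', h'⟩ := hc
  refine ⟨C * C', R * R', by positivity, by nlinarith, fun n => ?_⟩
  rw [abs_mul, mul_pow, mul_mul_mul_comm]
  exact mul_le_mul (h n) (h' n) (abs_nonneg _) (by positivity)

lemma add (ha : ExpBounded a) (hc : ExpBounded c) : ExpBounded fun n => a n + c n := by
  obtain ⟨C, R, hC, hR, h⟩ := ha
  obtain ⟨C', R', hC', hR', h'⟩ := hc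
  refine ⟨C + C', R * R', by positivity, by nlinarith, fun n => ?_⟩
  have h1 : R ^ n ≤ (R * R') ^ n := by gcongr; nlinarith
  have h2 : R' ^ n ≤ (R * R') ^ n := by gcongr; nlinarith
  calc |a n + c n| ≤ |a n| + |c n| := abs_add_le _ _
    _ ≤ C * R ^ n + C' * R' ^ n := add_le_add (h n) (h' n)
    _ ≤ C * (R * R') ^ n + C' * (R * R') ^ n := by gcongr
    _ = _ := by ring

lemma binomConv {p q : ℝ} (hp : 0 ≤ p) (hq : 0 ≤ q) (hpq : p + q = 1)
    (ha : ExpBounded a) (hc : ExpBounded c) : ExpBounded (binomConv p q a c) := by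
  obtain ⟨C, R, hC, hR, h⟩ := ha
  obtain ⟨C', R', hC', hR', h'⟩ := hc
  refine ⟨C * C', R * R', by positivity, by nlinarith, fun n => ?_⟩
  have hterm : ∀ j ∈ Finset.range (n + 1),
      |(n.choose j : ℝ) * p ^ j * q ^ (n - j) * (a j * c (n - j))| ≤
        p ^ j * q ^ (n - j) * (n.choose j : ℝ) * (C * C' * (R * R') ^ n) := by
    intro j hj
    have hjn : j ≤ n := Nat.lt_succ_iff.1 (Finset.mem_range.1 hj)
    rw [abs_mul, abs_mul (a j), abs_of_nonneg (by positivity :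
      0 ≤ (n.choose j : ℝ) * p ^ j * q ^ (n - j))]
    have h1 : R ^ j ≤ R ^ n := pow_le_pow_right₀ (by linarith) hjn
    have h2 : R' ^ (n - j) ≤ R' ^ n := pow_le_pow_right₀ (by linarith) (Nat.sub_le _ _)
    have h3 : |a j| * |c (n - j)| ≤ C * C' * (R * R') ^ n := by
      calc |a j| * |c (n - j)| ≤ (C * R ^ j) * (C' * R' ^ (n - j)) :=
            mul_le_mul (h _) (h' _) (abs_nonneg _) (by positivity)
        _ ≤ (C * R ^ n) * (C' * R' ^ n) := by gcongr
        _ = _ := by rw [mul_pow]; ring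
    calc _ ≤ (n.choose j : ℝ) * p ^ j * q ^ (n - j) * (C * C' * (R * R') ^ n) := by gcongr
      _ = _ := by ring
  calc _ ≤ _ := Finset.abs_sum_le_sum_abs _ _
    _ ≤ _ := Finset.sum_le_sum hterm
    _ = _ := by rw [← Finset.sum_mul, ← add_pow, hpq, one_pow, one_mul]

/-- A sequence solving the trie recurrence with an exponentially bounded toll is exponentially
bounded. -/
lemma of_trie_recurrence {p q : ℝ} (hp : 0 < p) (hq : 0 < q) (hpq : p + q = 1) {t : ℕ → ℝ}
    (ht : ExpBounded t) (h0 : a 0 = 0) (h1 : a 1 = 0)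
    (hrec : ∀ n, 2 ≤ n → a n = _root_.binomConv p q a 1 n + _root_.binomConv p q 1 a n + t n) :
    ExpBounded a := by
  obtain ⟨T, R, hT, hR, hbd⟩ := ht
  refine ⟨T / (p * q), R, by positivity, hR, fun n => ?_⟩
  set C := T / (p * q) with hCdef
  have hC : 0 ≤ C := by positivity
  have hTC : T = C * (p * q) := by rw [hCdef]; field_simp
  induction n using Nat.strong_induction_on with
  | _ n ih =>
  have hRn : ∀ m, 0 ≤ C * R ^ m := fun m => by positivity
  rcases Nat.lt_or_ge n 2 with hn | hn
  · interval_cases n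
    · simpa [h0] using hRn 0
    · simpa [h1] using hRn 1
  obtain ⟨m, rfl⟩ : ∃ m, n = m + 1 := ⟨n - 1, by omega⟩
  let w : ℕ → ℝ := fun j => p ^ j * q ^ (m + 1 - j) * ((m + 1).choose j : ℝ)
  have hw : ∀ j, 0 ≤ w j := fun j => by positivity
  have hsum : ∑ j ∈ Finset.range m, w (j + 1) = 1 - p ^ (m + 1) - q ^ (m + 1) := by
    have := add_pow p q (m + 1)
    rw [hpq, one_pow, Finset.sum_range_succ, Finset.sum_range_succ'] at this
    simp only [Nat.choose_self, Nat.choose_zero_right, pow_zero, Nat.sub_zero, Nat.sub_self,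
      Nat.cast_one, mul_one, one_mul] at this
    linarith
  have hD : 2 * (p * q) ≤ 1 - p ^ (m + 1) - q ^ (m + 1) := by
    have hp2 : p ^ (m + 1) ≤ p ^ 2 := pow_le_pow_of_le_one hp.le (by linarith) hn
    have hq2 : q ^ (m + 1) ≤ q ^ 2 := pow_le_pow_of_le_one hq.le (by linarith) hn
    nlinarith
  set D := 1 - p ^ (m + 1) - q ^ (m + 1) with hDdef
  have hexp : a (m + 1) * D = ∑ j ∈ Finset.range m, w (j + 1) * (a (j + 1) + a (m - j))
      + t (m + 1) := by
    have h := hrec (m + 1) hn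
    have h2 : _root_.binomConv p q a 1 (m + 1) + _root_.binomConv p q 1 a (m + 1)
        = ∑ j ∈ Finset.range (m + 1 + 1), w j * (a j + a (m + 1 - j)) := by
      rw [_root_.binomConv, _root_.binomConv, ← Finset.sum_add_distrib]
      refine Finset.sum_congr rfl fun j _ => ?_
      simp only [w, Pi.one_apply]; ring
    rw [h2, Finset.sum_range_succ, Finset.sum_range_succ'] at h
    simp only [w, Nat.choose_self, Nat.choose_zero_right, pow_zero, Nat.sub_zero, Nat.sub_self,
      Nat.cast_one, mul_one, one_mul, h0, add_zero, zero_add, Nat.add_sub_add_right] at h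
    simp only [w, hDdef, Nat.add_sub_add_right]
    linear_combination h
  have hmid : |∑ j ∈ Finset.range m, w (j + 1) * (a (j + 1) + a (m - j))|
      ≤ D * (2 * (C * R ^ m)) := by
    rw [← hsum, Finset.sum_mul]
    refine (Finset.abs_sum_le_sum_abs _ _).trans (Finset.sum_le_sum fun j hj => ?_)
    have hj := Finset.mem_range.1 hj
    rw [abs_mul, abs_of_nonneg (hw _)]
    refine mul_le_mul_of_nonneg_left ?_ (hw _)
    have e1 : R ^ (j + 1) ≤ R ^ m := pow_le_pow_right₀ (by linarith) hj
    have e2 : R ^ (m - j) ≤ R ^ m := pow_le_pow_right₀ (by linarith) (Nat.sub_le _ _)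
    have i1 := ih (j + 1) (by omega)
    have i2 := ih (m - j) (by omega)
    have := abs_add_le (a (j + 1)) (a (m - j))
    have := mul_le_mul_of_nonneg_left e1 hC
    have := mul_le_mul_of_nonneg_left e2 hC
    linarith
  have hDpos : 0 < D := lt_of_lt_of_le (by positivity) hD
  have hb : |a (m + 1)| * D ≤ D * (2 * (C * R ^ m)) + T * R ^ (m + 1) := by
    rw [← abs_of_pos hDpos, ← abs_mul, abs_of_pos hDpos, hexp]
    exact (abs_add_le _ _).trans (add_le_add hmid (hbd _))
  refine le_of_mul_le_mul_right (hb.trans ?_) hDpos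
  have hCR := hRn m
  have hstep : D * (2 * (C * R ^ m)) ≤ D * (C * R ^ (m + 1) / 2) := by
    refine mul_le_mul_of_nonneg_left ?_ hDpos.le
    rw [pow_succ]; nlinarith
  have hT' : T * R ^ (m + 1) ≤ D * (C * R ^ (m + 1) / 2) := by
    have := hRn (m + 1)
    rw [hTC]; nlinarith
  linarith

lemma summable_norm (ha : ExpBounded a) (z : ℂ) :
    Summable fun n : ℕ => ‖(a n : ℂ) * z ^ n / (n.factorial : ℂ)‖ := by
  obtain ⟨C, R, hC, hR, h⟩ := ha
  refine Summable.of_nonneg_of_le (fun _ => norm_nonneg _) (fun n => ?_)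
    ((Real.summable_pow_div_factorial (R * ‖z‖)).mul_left C)
  rw [norm_div, norm_mul, norm_pow, Complex.norm_natCast, Complex.norm_real, Real.norm_eq_abs,
    mul_pow, ← mul_div_assoc, ← mul_assoc]
  gcongr
  exact h n

lemma summable (ha : ExpBounded a) (z : ℂ) :
    Summable fun n : ℕ => (a n : ℂ) * z ^ n / (n.factorial : ℂ) :=
  (ha.summable_norm z).of_norm

lemma egf_add (ha : ExpBounded a) (hc : ExpBounded c) (z : ℂ) :
    egf (fun n => a n + c n) z = egf a z + egf c z := by
  rw [egf, egf, egf, ← (ha.summable z).tsum_add (hc.summable z)]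
  refine tsum_congr fun n => ?_
  push_cast; ring

lemma egf_binomConv (p q : ℝ) (ha : ExpBounded a) (hc : ExpBounded c) (z : ℂ) :
    egf (_root_.binomConv p q a c) z = egf a (p * z) * egf c (q * z) := by
  rw [egf, egf, egf, tsum_mul_tsum_eq_tsum_sum_range_of_summable_norm
    (ha.summable_norm _) (hc.summable_norm _)]
  refine tsum_congr fun n => ?_
  rw [_root_.binomConv, Complex.ofReal_sum, Finset.sum_mul, Finset.sum_div]
  refine Finset.sum_congr rfl fun j hj => ?_
  have hjn : j ≤ n := Nat.lt_succ_iff.1 (Finset.mem_range.1 hj)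
  have hf : (n.choose j : ℂ) * j.factorial * (n - j).factorial = n.factorial := by
    exact_mod_cast Nat.choose_mul_factorial_mul_factorial hjn
  have hz : z ^ n = z ^ j * z ^ (n - j) := by rw [← pow_add, Nat.add_sub_cancel' hjn]
  have h1 : (j.factorial : ℂ) ≠ 0 := by exact_mod_cast j.factorial_ne_zero
  have h2 : ((n - j).factorial : ℂ) ≠ 0 := by exact_mod_cast (n - j).factorial_ne_zero
  have h3 : (n.choose j : ℂ) ≠ 0 := by exact_mod_cast (Nat.choose_pos hjn).ne'
  rw [← hf, hz, mul_pow, mul_pow]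
  push_cast
  field_simp

lemma hasDerivAt_egf (ha : ExpBounded a) (z : ℂ) :
    HasDerivAt (egf a) (deriv (egf a) z) z ∧
      egf (fun n => n * a n) z = z * deriv (egf a) z := by
  have hu := ha.summable_norm ((‖z‖ + 1 : ℝ) : ℂ)
  have hF : ∀ n : ℕ, DifferentiableOn ℂ
      (fun w : ℂ => (a n : ℂ) * w ^ n / (n.factorial : ℂ)) (Metric.ball 0 (‖z‖ + 1)) :=
    fun n => by fun_prop
  have hle : ∀ (n : ℕ) (w : ℂ), w ∈ Metric.ball (0 : ℂ) (‖z‖ + 1) →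
      ‖(a n : ℂ) * w ^ n / (n.factorial : ℂ)‖ ≤
        ‖(a n : ℂ) * ((‖z‖ + 1 : ℝ) : ℂ) ^ n / (n.factorial : ℂ)‖ := by
    intro n w hw
    have hw : ‖w‖ ≤ ‖z‖ + 1 := by simpa using (Metric.mem_ball.1 hw).le
    rw [norm_div, norm_div, norm_mul, norm_mul, norm_pow, norm_pow, Complex.norm_real (‖z‖ + 1),
      Real.norm_of_nonneg (by positivity : (0 : ℝ) ≤ ‖z‖ + 1)]
    gcongr
  have hz : z ∈ Metric.ball (0 : ℂ) (‖z‖ + 1) := by simp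
  refine ⟨((Complex.differentiableOn_tsum_of_summable_norm hu hF Metric.isOpen_ball hle
    ).differentiableAt (Metric.isOpen_ball.mem_nhds hz)).hasDerivAt, ?_⟩
  have hs := (Complex.hasSum_deriv_of_summable_norm hu hF Metric.isOpen_ball hle hz).mul_left z
  refine Eq.trans (tsum_congr fun n => ?_) hs.tsum_eq
  rcases n with _ | n
  · simp
  · rw [(((hasDerivAt_pow (n + 1) z).const_mul (a (n + 1) : ℂ)).div_const _).deriv]
    push_cast [Nat.add_sub_cancel]
    ring

end ExpBounded

lemma egf_one (z : ℂ) : egf 1 z = Complex.exp z := by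
  rw [egf, Complex.exp_eq_exp_ℂ, NormedSpace.exp_eq_tsum_div]
  simp

lemma ExpBounded.one : ExpBounded 1 := .of_abs_le_one fun _ => by simp

lemma egf_ite_one (z : ℂ) :
    egf (fun n => if n < 2 then 0 else 1) z = Complex.exp z - 1 - z := by
  have h := (ExpBounded.one.summable z).sum_add_tsum_nat_add 2
  have hb : ExpBounded fun n => if n < 2 then 0 else 1 :=
    .of_abs_le_one fun n => by split_ifs <;> simp
  have h' := (hb.summable z).sum_add_tsum_nat_add 2
  rw [← egf_one, egf, egf, ← h, ← h']
  simp [Finset.sum_range_succ]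
  ring

lemma egf_ite_natCast (z : ℂ) :
    egf (fun n => if n < 2 then 0 else (n : ℝ)) z = z * (Complex.exp z - 1) := by
  have hb : ExpBounded fun n => if n < 2 then 0 else 1 :=
    .of_abs_le_one fun n => by split_ifs <;> simp
  have h := (hb.hasDerivAt_egf z).2
  rw [funext egf_ite_one] at h
  simp only [mul_ite, mul_zero, mul_one] at h
  rw [h]
  simp

lemma binomConv_one_one {p q : ℝ} (hpq : p + q = 1) (n : ℕ) : binomConv p q 1 1 n = 1 := by
  have h := add_pow p q n
  rw [hpq, one_pow] at h
  rw [h, binomConv]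
  exact Finset.sum_congr rfl fun k _ => by simp only [Pi.one_apply]; ring

lemma binomConv_eq_zero {p q : ℝ} {a c : ℕ → ℝ} {n : ℕ} (hn : n < 2)
    (h : ∀ i < 2, ∀ j < 2, a i * c j = 0) : binomConv p q a c n = 0 := by
  refine Finset.sum_eq_zero fun j hj => ?_
  have := Finset.mem_range.1 hj
  rw [h j (by omega) (n - j) (by omega), mul_zero]

/-- Poisson generating function of a real sequence. -/
noncomputable def poissonGF (a : ℕ → ℝ) (z : ℂ) : ℂ := Complex.exp (-z) * egf a z

lemma poissonGF_one (z : ℂ) : poissonGF 1 z = 1 := by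
  rw [poissonGF, egf_one, ← Complex.exp_add, neg_add_cancel, Complex.exp_zero]

lemma poissonGF_ite_one (z : ℂ) :
    poissonGF (fun n => if n < 2 then 0 else 1) z = 1 - (1 + z) * Complex.exp (-z) := by
  have h : Complex.exp (-z) * Complex.exp z = 1 := by
    rw [← Complex.exp_add, neg_add_cancel, Complex.exp_zero]
  rw [poissonGF, egf_ite_one]
  linear_combination h

lemma poissonGF_ite_natCast (z : ℂ) :
    poissonGF (fun n => if n < 2 then 0 else (n : ℝ)) z = z * (1 - Complex.exp (-z)) := by
  have h : Complex.exp (-z) * Complex.exp z = 1 := by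
    rw [← Complex.exp_add, neg_add_cancel, Complex.exp_zero]
  rw [poissonGF, egf_ite_natCast]
  linear_combination z * h

namespace ExpBounded

variable {a c : ℕ → ℝ}

lemma ite_lt (ha : ExpBounded a) (m : ℕ) : ExpBounded fun n => if n < m then 0 else a n := by
  obtain ⟨C, R, hC, hR, h⟩ := ha
  refine ⟨C, R, hC, hR, fun n => ?_⟩
  dsimp only
  split_ifs
  · rw [abs_zero]; positivity
  · exact h n

lemma poissonGF_add (ha : ExpBounded a) (hc : ExpBounded c) (z : ℂ) :
    poissonGF (fun n => a n + c n) z = poissonGF a z + poissonGF c z := by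
  rw [poissonGF, ha.egf_add hc, mul_add]; rfl

lemma poissonGF_binomConv {p q : ℝ} (hpq : p + q = 1) (ha : ExpBounded a) (hc : ExpBounded c)
    (z : ℂ) : poissonGF (_root_.binomConv p q a c) z = poissonGF a (p * z) * poissonGF c (q * z) := by
  have hz : -z = -(p * z) + -(q * z) := by
    have : (p : ℂ) + q = 1 := by exact_mod_cast hpq
    linear_combination z * this
  rw [poissonGF, ha.egf_binomConv p q hc, hz, Complex.exp_add, poissonGF, poissonGF]
  ring

lemma hasDerivAt_poissonGF (ha : ExpBounded a) (z : ℂ) :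
    HasDerivAt (poissonGF a) (deriv (poissonGF a) z) z := by
  have h : DifferentiableAt ℂ (egf a) z := (ha.hasDerivAt_egf z).1.differentiableAt
  exact ((by fun_prop : DifferentiableAt ℂ (fun z : ℂ => Complex.exp (-z)) z).mul h).hasDerivAt

lemma poissonGF_natCast_mul (ha : ExpBounded a) (z : ℂ) :
    poissonGF (fun n => n * a n) z = z * (deriv (poissonGF a) z + poissonGF a z) := by
  obtain ⟨h1, h2⟩ := ha.hasDerivAt_egf z
  have h3 := ((hasDerivAt_neg z).cexp.mul h1).deriv
  have h4 : deriv (poissonGF a) z = _ := h3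
  rw [h4, poissonGF, h2, poissonGF]
  ring

end ExpBounded

namespace IsTriePairFamily

variable {p : ℝ} {μ : ℕ → Measure (ℕ × ℕ)}

lemma integrable_fst_s10 (hμ : IsTriePairFamily p μ) (n : ℕ) :
    Integrable (fun x : ℕ × ℕ => (x.1 : ℝ)) (μ n) := by
  refine (hμ.moments n 1).mono' (measurable_of_countable _).aestronglyMeasurable (ae_of_all _ ?_)
  intro x
  simp

lemma integrable_snd_s10 (hμ : IsTriePairFamily p μ) (n : ℕ) :
    Integrable (fun x : ℕ × ℕ => (x.2 : ℝ)) (μ n) := by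
  refine (hμ.moments n 1).mono' (measurable_of_countable _).aestronglyMeasurable (ae_of_all _ ?_)
  intro x
  simp

lemma integrable_mul (hμ : IsTriePairFamily p μ) (n : ℕ) :
    Integrable (fun x : ℕ × ℕ => (x.1 : ℝ) * (x.2 : ℝ)) (μ n) := by
  refine (hμ.moments n 2).mono' (measurable_of_countable _).aestronglyMeasurable (ae_of_all _ ?_)
  intro x
  have h1 : (0 : ℝ) ≤ x.1 := Nat.cast_nonneg _
  have h2 : (0 : ℝ) ≤ x.2 := Nat.cast_nonneg _
  rw [Real.norm_of_nonneg (by positivity)]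
  nlinarith

/-- The law of `(S_n, K_n)` as an explicit binomial mixture. -/
lemma eq_sum (hμ : IsTriePairFamily p μ) {n : ℕ} (hn : 2 ≤ n) :
    μ n = ∑ k ∈ Finset.range (n + 1),
      ENNReal.ofReal ((n.choose k : ℝ) * p ^ k * (1 - p) ^ (n - k)) •
        ((μ k).prod (μ (n - k))).map
          fun x => (x.1.1 + x.2.1 + 1, x.1.2 + x.2.2 + n) := by
  obtain ⟨P, hP, hB, h1, h2, hprod, hlaw⟩ := hμ.recur n hn
  set ν₁ := P.map fun ω => ω.2.1
  set ν₂ := P.map fun ω => ω.2.2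
  have m1 : Measurable fun ω : ℕ × ((ℕ → ℕ × ℕ) × (ℕ → ℕ × ℕ)) => ω.2.1 := by fun_prop
  have m2 : Measurable fun ω : ℕ × ((ℕ → ℕ × ℕ) × (ℕ → ℕ × ℕ)) => ω.2.2 := by fun_prop
  have : IsProbabilityMeasure ν₁ := Measure.isProbabilityMeasure_map m1.aemeasurable
  have : IsProbabilityMeasure ν₂ := Measure.isProbabilityMeasure_map m2.aemeasurable
  have hν₁ : ∀ j, μ j = ν₁.map fun y => y j := fun j => by
    rw [Measure.map_map (measurable_pi_apply j) m1, ← h1 j]; rfl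
  have hν₂ : ∀ j, μ j = ν₂.map fun y => y j := fun j => by
    rw [Measure.map_map (measurable_pi_apply j) m2, ← h2 j]; rfl
  have hslice : ∀ k, Measurable fun y : (ℕ → ℕ × ℕ) × (ℕ → ℕ × ℕ) => trieStep n (k, y) := by
    intro k
    have e1 : Measurable fun y : (ℕ → ℕ × ℕ) × (ℕ → ℕ × ℕ) => y.1 k := by fun_prop
    have e2 : Measurable fun y : (ℕ → ℕ × ℕ) × (ℕ → ℕ × ℕ) => y.2 (n - k) := by fun_prop
    exact (measurable_of_countable fun x : (ℕ × ℕ) × (ℕ × ℕ) =>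
      (x.1.1 + x.2.1 + 1, x.1.2 + x.2.2 + n)).comp (e1.prodMk e2)
  have hstep : Measurable (trieStep n) := measurable_from_prod_countable_right hslice
  rw [hlaw, hprod, hB, binomialMeasure]
  ext s hs
  rw [Measure.map_apply hstep hs, Measure.prod_apply (hstep hs), lintegral_finsetSum_measure,
    Measure.finsetSum_apply]
  refine Finset.sum_congr rfl fun k _ => ?_
  rw [lintegral_smul_measure, lintegral_dirac, Measure.smul_apply,
    Measure.map_apply (measurable_of_countable _) hs, hν₁ k, hν₂ (n - k),
    Measure.map_prod_map _ _ (measurable_pi_apply k) (measurable_pi_apply (n - k)),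
    Measure.map_apply ((measurable_pi_apply k).prodMap (measurable_pi_apply (n - k)))
      (measurable_of_countable _ hs)]
  rfl

lemma integral_eq_sum (hμ : IsTriePairFamily p μ) (hp0 : 0 < p) (hp1 : p < 1) {n : ℕ}
    (hn : 2 ≤ n) {F : ℕ × ℕ → ℝ} (hF : ∀ k, Integrable
      (fun x : (ℕ × ℕ) × (ℕ × ℕ) => F (x.1.1 + x.2.1 + 1, x.1.2 + x.2.2 + n))
      ((μ k).prod (μ (n - k)))) :
    ∫ x, F x ∂μ n = ∑ k ∈ Finset.range (n + 1), (n.choose k : ℝ) * p ^ k * (1 - p) ^ (n - k) *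
      ∫ x, F (x.1.1 + x.2.1 + 1, x.1.2 + x.2.2 + n) ∂(μ k).prod (μ (n - k)) := by
  have hmeas : Measurable fun x : (ℕ × ℕ) × (ℕ × ℕ) =>
    (x.1.1 + x.2.1 + 1, x.1.2 + x.2.2 + n) := measurable_of_countable _
  have hFm : ∀ ν : Measure (ℕ × ℕ), AEStronglyMeasurable F ν := fun ν =>
    (measurable_of_countable F).aestronglyMeasurable
  have hq : 0 < 1 - p := sub_pos.2 hp1
  rw [hμ.eq_sum hn, integral_finsetSum_measure]
  · refine Finset.sum_congr rfl fun k _ => ?_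
    rw [integral_smul_measure, integral_map hmeas.aemeasurable (hFm _),
      ENNReal.toReal_ofReal (by positivity), smul_eq_mul]
  · intro k _
    exact ((integrable_map_measure (hFm _) hmeas.aemeasurable).2 (hF k)).smul_measure
      ENNReal.ofReal_ne_top

lemma eS_rec (hμ : IsTriePairFamily p μ) (hp0 : 0 < p) (hp1 : p < 1) {n : ℕ} (hn : 2 ≤ n) :
    eS μ n = binomConv p (1 - p) (eS μ) 1 n + binomConv p (1 - p) 1 (eS μ) n + 1 := by
  have := hμ.prob
  have i1 := fun k => (hμ.integrable_fst_s10 k).comp_fst (μ (n - k))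
  have i2 := fun k => (hμ.integrable_fst_s10 (n - k)).comp_snd (μ k)
  have key := hμ.integral_eq_sum hp0 hp1 hn (F := fun x => (x.1 : ℝ)) fun k => by
    simp only [Nat.cast_add, Nat.cast_one]
    exact ((i1 k).fun_add (i2 k)).fun_add (integrable_const _)
  have hpq := add_sub_cancel p 1
  generalize 1 - p = q at key hpq ⊢
  rw [eS, key, ← binomConv_one_one hpq n]
  simp only [binomConv, ← Finset.sum_add_distrib]
  refine Finset.sum_congr rfl fun k _ => ?_
  simp only [Nat.cast_add, Nat.cast_one]
  rw [integral_add ((i1 k).fun_add (i2 k)) (integrable_const _), integral_add (i1 k) (i2 k),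
    integral_fun_fst (fun x : ℕ × ℕ => (x.1 : ℝ)), integral_fun_snd (fun x : ℕ × ℕ => (x.1 : ℝ))]
  simp only [eS, integral_const, probReal_univ, one_smul, Pi.one_apply]
  ring

lemma eK_rec (hμ : IsTriePairFamily p μ) (hp0 : 0 < p) (hp1 : p < 1) {n : ℕ} (hn : 2 ≤ n) :
    eK μ n = binomConv p (1 - p) (eK μ) 1 n + binomConv p (1 - p) 1 (eK μ) n + n := by
  have := hμ.prob
  have i1 := fun k => (hμ.integrable_snd_s10 k).comp_fst (μ (n - k))
  have i2 := fun k => (hμ.integrable_snd_s10 (n - k)).comp_snd (μ k)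
  have key := hμ.integral_eq_sum hp0 hp1 hn (F := fun x => (x.2 : ℝ)) fun k => by
    simp only [Nat.cast_add]
    exact ((i1 k).fun_add (i2 k)).fun_add (integrable_const _)
  have hpq := add_sub_cancel p 1
  generalize 1 - p = q at key hpq ⊢
  rw [eK, key, ← mul_one (n : ℝ), ← binomConv_one_one hpq n]
  simp only [binomConv, Finset.mul_sum, ← Finset.sum_add_distrib]
  refine Finset.sum_congr rfl fun k _ => ?_
  simp only [Nat.cast_add]
  rw [integral_add ((i1 k).fun_add (i2 k)) (integrable_const _), integral_add (i1 k) (i2 k),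
    integral_fun_fst (fun x : ℕ × ℕ => (x.2 : ℝ)), integral_fun_snd (fun x : ℕ × ℕ => (x.2 : ℝ))]
  simp only [eK, integral_const, probReal_univ, Pi.one_apply, smul_eq_mul]
  ring

lemma eSK_rec (hμ : IsTriePairFamily p μ) (hp0 : 0 < p) (hp1 : p < 1) {n : ℕ} (hn : 2 ≤ n) :
    eSK μ n = binomConv p (1 - p) (eSK μ) 1 n + binomConv p (1 - p) 1 (eSK μ) n
      + (binomConv p (1 - p) (eS μ) (eK μ) n + binomConv p (1 - p) (eK μ) (eS μ) n
        + n * (binomConv p (1 - p) (eS μ) 1 n + binomConv p (1 - p) 1 (eS μ) n)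
        + (binomConv p (1 - p) (eK μ) 1 n + binomConv p (1 - p) 1 (eK μ) n) + n) := by
  have := hμ.prob
  have iS := fun k => (hμ.integrable_fst_s10 k).comp_fst (μ (n - k))
  have iS' := fun k => (hμ.integrable_fst_s10 (n - k)).comp_snd (μ k)
  have iK := fun k => (hμ.integrable_snd_s10 k).comp_fst (μ (n - k))
  have iK' := fun k => (hμ.integrable_snd_s10 (n - k)).comp_snd (μ k)
  have iM := fun k => (hμ.integrable_mul k).comp_fst (μ (n - k))
  have iM' := fun k => (hμ.integrable_mul (n - k)).comp_snd (μ k)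
  have iSK := fun k => (hμ.integrable_fst_s10 k).mul_prod (hμ.integrable_snd_s10 (n - k))
  have iKS := fun k => (hμ.integrable_snd_s10 k).mul_prod (hμ.integrable_fst_s10 (n - k))
  have hexp : ∀ x : (ℕ × ℕ) × (ℕ × ℕ),
      ((x.1.1 + x.2.1 + 1 : ℕ) : ℝ) * ((x.1.2 + x.2.2 + n : ℕ) : ℝ) =
        (x.1.1 : ℝ) * x.1.2 + (x.2.1 : ℝ) * x.2.2 + (x.1.1 : ℝ) * x.2.2 + (x.1.2 : ℝ) * x.2.1
          + n * ((x.1.1 : ℝ) + x.2.1) + ((x.1.2 : ℝ) + x.2.2) + n := fun x => by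
    push_cast; ring
  have j1 := fun k => (iM k).fun_add (iM' k)
  have j2 := fun k => (j1 k).fun_add (iSK k)
  have j3 := fun k => (j2 k).fun_add (iKS k)
  have jS := fun k => ((iS k).fun_add (iS' k)).const_mul (n : ℝ)
  have j4 := fun k => (j3 k).fun_add (jS k)
  have jK := fun k => (iK k).fun_add (iK' k)
  have j5 := fun k => (j4 k).fun_add (jK k)
  have key := hμ.integral_eq_sum hp0 hp1 hn (F := fun x => (x.1 : ℝ) * (x.2 : ℝ)) fun k => by
    simp only [hexp]
    exact (j5 k).fun_add (integrable_const _)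
  have hpq := add_sub_cancel p 1
  generalize 1 - p = q at key hpq ⊢
  rw [eSK, key]
  nth_rw 2 [← mul_one (n : ℝ)]
  rw [← binomConv_one_one hpq n]
  simp only [binomConv, Finset.mul_sum, ← Finset.sum_add_distrib]
  refine Finset.sum_congr rfl fun k _ => ?_
  simp only [hexp]
  rw [integral_add (j5 k) (integrable_const _), integral_add (j4 k) (jK k),
    integral_add (j3 k) (jS k), integral_add (j2 k) (iKS k), integral_add (j1 k) (iSK k),
    integral_add (iM k) (iM' k), integral_const_mul, integral_add (iS k) (iS' k),
    integral_add (iK k) (iK' k),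
    integral_fun_fst (fun x : ℕ × ℕ => (x.1 : ℝ)), integral_fun_snd (fun x : ℕ × ℕ => (x.1 : ℝ)),
    integral_fun_fst (fun x : ℕ × ℕ => (x.2 : ℝ)), integral_fun_snd (fun x : ℕ × ℕ => (x.2 : ℝ)),
    integral_fun_fst (fun x : ℕ × ℕ => (x.1 : ℝ) * (x.2 : ℝ)),
    integral_fun_snd (fun x : ℕ × ℕ => (x.1 : ℝ) * (x.2 : ℝ)),
    integral_prod_mul (fun x : ℕ × ℕ => (x.1 : ℝ)) (fun x : ℕ × ℕ => (x.2 : ℝ)),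
    integral_prod_mul (fun x : ℕ × ℕ => (x.2 : ℝ)) (fun x : ℕ × ℕ => (x.1 : ℝ))]
  simp only [eS, eK, eSK, integral_const, probReal_univ, Pi.one_apply, smul_eq_mul]
  ring

lemma eq_dirac (hμ : IsTriePairFamily p μ) {n : ℕ} (hn : n < 2) : μ n = Measure.dirac (0, 0) := by
  interval_cases n
  exacts [hμ.init0, hμ.init1]

lemma eS_eq_zero (hμ : IsTriePairFamily p μ) {n : ℕ} (hn : n < 2) : eS μ n = 0 := by
  rw [eS, hμ.eq_dirac hn, integral_dirac]; simp

lemma eK_eq_zero (hμ : IsTriePairFamily p μ) {n : ℕ} (hn : n < 2) : eK μ n = 0 := by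
  rw [eK, hμ.eq_dirac hn, integral_dirac]; simp

lemma eSK_eq_zero (hμ : IsTriePairFamily p μ) {n : ℕ} (hn : n < 2) : eSK μ n = 0 := by
  rw [eSK, hμ.eq_dirac hn, integral_dirac]; simp

lemma expBounded_eS (hμ : IsTriePairFamily p μ) (hp0 : 0 < p) (hp1 : p < 1) :
    ExpBounded (eS μ) :=
  .of_trie_recurrence hp0 (sub_pos.2 hp1) (add_sub_cancel p 1) .one
    (hμ.eS_eq_zero (by norm_num)) (hμ.eS_eq_zero (by norm_num)) fun _ => hμ.eS_rec hp0 hp1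

lemma expBounded_eK (hμ : IsTriePairFamily p μ) (hp0 : 0 < p) (hp1 : p < 1) :
    ExpBounded (eK μ) :=
  .of_trie_recurrence hp0 (sub_pos.2 hp1) (add_sub_cancel p 1) .natCast
    (hμ.eK_eq_zero (by norm_num)) (hμ.eK_eq_zero (by norm_num)) fun _ => hμ.eK_rec hp0 hp1

lemma expBounded_eSK (hμ : IsTriePairFamily p μ) (hp0 : 0 < p) (hp1 : p < 1) :
    ExpBounded (eSK μ) := by
  have hs := hμ.expBounded_eS hp0 hp1
  have hk := hμ.expBounded_eK hp0 hp1
  have conv : ∀ {a c : ℕ → ℝ}, ExpBounded a → ExpBounded c →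
      ExpBounded (binomConv p (1 - p) a c) := fun ha hc =>
    ha.binomConv hp0.le (sub_pos.2 hp1).le (add_sub_cancel p 1) hc
  exact .of_trie_recurrence hp0 (sub_pos.2 hp1) (add_sub_cancel p 1)
    (((((conv hs hk).add (conv hk hs)).add
      (.mul .natCast ((conv hs .one).add (conv .one hs)))).add
      ((conv hk .one).add (conv .one hk))).add .natCast)
    (hμ.eSK_eq_zero (by norm_num)) (hμ.eSK_eq_zero (by norm_num)) fun _ => hμ.eSK_rec hp0 hp1

lemma pgfS_eq (hμ : IsTriePairFamily p μ) (hp0 : 0 < p) (hp1 : p < 1) (z : ℂ) :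
    pgfS μ z = pgfS μ (p * z) + pgfS μ ((1 - p : ℝ) * z) + (1 - (1 + z) * Complex.exp (-z)) := by
  have hs := hμ.expBounded_eS hp0 hp1
  have hpq := add_sub_cancel p 1
  have hq := (sub_pos.2 hp1).le
  have b1 := hs.binomConv hp0.le hq hpq .one
  have b2 := ExpBounded.one.binomConv hp0.le hq hpq hs
  have hfun : eS μ = fun n => binomConv p (1 - p) (eS μ) 1 n + binomConv p (1 - p) 1 (eS μ) n
      + if n < 2 then 0 else 1 := by
    funext n
    split_ifs with hn
    · rw [binomConv_eq_zero hn fun i hi j _ => by rw [hμ.eS_eq_zero hi, zero_mul],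
        binomConv_eq_zero hn fun i _ j hj => by rw [hμ.eS_eq_zero hj, mul_zero],
        hμ.eS_eq_zero hn]
      simp
    · exact hμ.eS_rec hp0 hp1 (not_lt.1 hn)
  change poissonGF (eS μ) z = poissonGF (eS μ) _ + poissonGF (eS μ) _ + _
  conv_lhs => rw [hfun]
  have hb : ExpBounded fun n => if n < 2 then 0 else 1 := ExpBounded.one.ite_lt 2
  rw [(b1.add b2).poissonGF_add hb, b1.poissonGF_add b2,
    hs.poissonGF_binomConv hpq .one, ExpBounded.one.poissonGF_binomConv hpq hs,
    poissonGF_one, poissonGF_one, mul_one, one_mul, poissonGF_ite_one]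

lemma pgfK_eq (hμ : IsTriePairFamily p μ) (hp0 : 0 < p) (hp1 : p < 1) (z : ℂ) :
    pgfK μ z = pgfK μ (p * z) + pgfK μ ((1 - p : ℝ) * z) + z * (1 - Complex.exp (-z)) := by
  have hk := hμ.expBounded_eK hp0 hp1
  have hpq := add_sub_cancel p 1
  have hq := (sub_pos.2 hp1).le
  have b1 := hk.binomConv hp0.le hq hpq .one
  have b2 := ExpBounded.one.binomConv hp0.le hq hpq hk
  have hfun : eK μ = fun n => binomConv p (1 - p) (eK μ) 1 n + binomConv p (1 - p) 1 (eK μ) n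
      + if n < 2 then 0 else (n : ℝ) := by
    funext n
    split_ifs with hn
    · rw [binomConv_eq_zero hn fun i hi j _ => by rw [hμ.eK_eq_zero hi, zero_mul],
        binomConv_eq_zero hn fun i _ j hj => by rw [hμ.eK_eq_zero hj, mul_zero],
        hμ.eK_eq_zero hn]
      simp
    · exact hμ.eK_rec hp0 hp1 (not_lt.1 hn)
  change poissonGF (eK μ) z = poissonGF (eK μ) _ + poissonGF (eK μ) _ + _
  conv_lhs => rw [hfun]
  rw [(b1.add b2).poissonGF_add (ExpBounded.natCast.ite_lt 2), b1.poissonGF_add b2,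
    hk.poissonGF_binomConv hpq .one, ExpBounded.one.poissonGF_binomConv hpq hk,
    poissonGF_one, poissonGF_one, mul_one, one_mul, poissonGF_ite_natCast]

lemma hasDerivAt_pgfS (hμ : IsTriePairFamily p μ) (hp0 : 0 < p) (hp1 : p < 1) (z : ℂ) :
    HasDerivAt (pgfS μ) (deriv (pgfS μ) z) z :=
  (hμ.expBounded_eS hp0 hp1).hasDerivAt_poissonGF z

lemma hasDerivAt_pgfK (hμ : IsTriePairFamily p μ) (hp0 : 0 < p) (hp1 : p < 1) (z : ℂ) :
    HasDerivAt (pgfK μ) (deriv (pgfK μ) z) z :=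
  (hμ.expBounded_eK hp0 hp1).hasDerivAt_poissonGF z

lemma hasDerivAt_pgfS_add (hμ : IsTriePairFamily p μ) (hp0 : 0 < p) (hp1 : p < 1) (z : ℂ) :
    HasDerivAt (fun w => pgfS μ (p * w) + pgfS μ ((1 - p : ℝ) * w))
      (p * deriv (pgfS μ) (p * z) + (1 - p : ℝ) * deriv (pgfS μ) ((1 - p : ℝ) * z)) z := by
  have h := fun c : ℂ => (hμ.hasDerivAt_pgfS hp0 hp1 (c * z)).comp z (hasDerivAt_const_mul c)
  exact ((h p).add (h (1 - p : ℝ))).congr_deriv (by ring)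

lemma hasDerivAt_pgfK_add (hμ : IsTriePairFamily p μ) (hp0 : 0 < p) (hp1 : p < 1) (z : ℂ) :
    HasDerivAt (fun w => pgfK μ (p * w) + pgfK μ ((1 - p : ℝ) * w))
      (p * deriv (pgfK μ) (p * z) + (1 - p : ℝ) * deriv (pgfK μ) ((1 - p : ℝ) * z)) z := by
  have h := fun c : ℂ => (hμ.hasDerivAt_pgfK hp0 hp1 (c * z)).comp z (hasDerivAt_const_mul c)
  exact ((h p).add (h (1 - p : ℝ))).congr_deriv (by ring)

lemma deriv_pgfS_eq (hμ : IsTriePairFamily p μ) (hp0 : 0 < p) (hp1 : p < 1) (z : ℂ) :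
    deriv (pgfS μ) z = p * deriv (pgfS μ) (p * z)
      + (1 - p : ℝ) * deriv (pgfS μ) ((1 - p : ℝ) * z) + z * Complex.exp (-z) := by
  have he := (hasDerivAt_neg z).cexp
  have ht := (((hasDerivAt_id z).const_add 1).mul he).const_sub 1
  have h := (hμ.hasDerivAt_pgfS_add hp0 hp1 z).add ht
  have h' := (h.congr_of_eventuallyEq (.of_forall (hμ.pgfS_eq hp0 hp1))).deriv
  rw [h']
  simp only [id]
  ring

lemma deriv_pgfK_eq (hμ : IsTriePairFamily p μ) (hp0 : 0 < p) (hp1 : p < 1) (z : ℂ) :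
    deriv (pgfK μ) z = p * deriv (pgfK μ) (p * z)
      + (1 - p : ℝ) * deriv (pgfK μ) ((1 - p : ℝ) * z)
      + (1 - Complex.exp (-z) + z * Complex.exp (-z)) := by
  have he := (hasDerivAt_neg z).cexp
  have ht := (hasDerivAt_id z).mul (he.const_sub 1)
  have h := (hμ.hasDerivAt_pgfK_add hp0 hp1 z).add ht
  have h' := (h.congr_of_eventuallyEq (.of_forall (hμ.pgfK_eq hp0 hp1))).deriv
  rw [h']
  simp only [id]
  ring

lemma pgfSK_eq (hμ : IsTriePairFamily p μ) (hp0 : 0 < p) (hp1 : p < 1) (z : ℂ) :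
    pgfSK μ z = pgfSK μ (p * z) + pgfSK μ ((1 - p : ℝ) * z)
      + (pgfS μ (p * z) * pgfK μ ((1 - p : ℝ) * z) + pgfK μ (p * z) * pgfS μ ((1 - p : ℝ) * z)
        + z * (p * deriv (pgfS μ) (p * z) + (1 - p : ℝ) * deriv (pgfS μ) ((1 - p : ℝ) * z)
          + (pgfS μ (p * z) + pgfS μ ((1 - p : ℝ) * z)))
        + (pgfK μ (p * z) + pgfK μ ((1 - p : ℝ) * z)) + z * (1 - Complex.exp (-z))) := by
  have hs := hμ.expBounded_eS hp0 hp1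
  have hk := hμ.expBounded_eK hp0 hp1
  have hm := hμ.expBounded_eSK hp0 hp1
  have h1 := ExpBounded.one
  have hpq := add_sub_cancel p 1
  have conv : ∀ {a c : ℕ → ℝ}, ExpBounded a → ExpBounded c →
      ExpBounded (binomConv p (1 - p) a c) := fun ha hc =>
    ha.binomConv hp0.le (sub_pos.2 hp1).le hpq hc
  have hfun : eSK μ = fun n => binomConv p (1 - p) (eSK μ) 1 n + binomConv p (1 - p) 1 (eSK μ) n
      + (binomConv p (1 - p) (eS μ) (eK μ) n + binomConv p (1 - p) (eK μ) (eS μ) n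
        + n * (binomConv p (1 - p) (eS μ) 1 n + binomConv p (1 - p) 1 (eS μ) n)
        + (binomConv p (1 - p) (eK μ) 1 n + binomConv p (1 - p) 1 (eK μ) n)
        + if n < 2 then 0 else (n : ℝ)) := by
    funext n
    split_ifs with hn
    · have left : ∀ {a : ℕ → ℝ} (c : ℕ → ℝ), (∀ {i}, i < 2 → a i = 0) →
          binomConv p (1 - p) a c n = 0 := fun c ha =>
        binomConv_eq_zero hn fun i hi j _ => by rw [ha hi, zero_mul]
      have right : ∀ {c : ℕ → ℝ}, (∀ {i}, i < 2 → c i = 0) →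
          binomConv p (1 - p) 1 c n = 0 := fun hc =>
        binomConv_eq_zero hn fun i _ j hj => by rw [hc hj, mul_zero]
      rw [left _ hμ.eSK_eq_zero, right hμ.eSK_eq_zero, left _ hμ.eS_eq_zero,
        left _ hμ.eS_eq_zero, right hμ.eS_eq_zero, left _ hμ.eK_eq_zero,
        left _ hμ.eK_eq_zero, right hμ.eK_eq_zero, hμ.eSK_eq_zero hn]
      simp
    · exact hμ.eSK_rec hp0 hp1 (not_lt.1 hn)
  have bm := (conv hm h1).add (conv h1 hm)
  have bs := (conv hs h1).add (conv h1 hs)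
  have bk := (conv hk h1).add (conv h1 hk)
  have bc := (conv hs hk).add (conv hk hs)
  have bn := ExpBounded.natCast.mul bs
  have hsplit : ∀ {a : ℕ → ℝ}, ExpBounded a → ∀ w,
      poissonGF (fun n => binomConv p (1 - p) a 1 n + binomConv p (1 - p) 1 a n) w
        = poissonGF a (p * w) + poissonGF a ((1 - p : ℝ) * w) := fun ha w => by
    rw [(conv ha h1).poissonGF_add (conv h1 ha), ha.poissonGF_binomConv hpq h1,
      h1.poissonGF_binomConv hpq ha, poissonGF_one, poissonGF_one, mul_one, one_mul]
  have hderiv : deriv (poissonGF fun n =>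
      binomConv p (1 - p) (eS μ) 1 n + binomConv p (1 - p) 1 (eS μ) n) z =
      p * deriv (pgfS μ) (p * z) + (1 - p : ℝ) * deriv (pgfS μ) ((1 - p : ℝ) * z) := by
    rw [funext (hsplit hs)]
    exact (hμ.hasDerivAt_pgfS_add hp0 hp1 z).deriv
  calc pgfSK μ z = poissonGF (eSK μ) z := rfl
    _ = _ := by
      conv_lhs => rw [hfun]
      rw [bm.poissonGF_add (((bc.add bn).add bk).add (ExpBounded.natCast.ite_lt 2)),
        ((bc.add bn).add bk).poissonGF_add (ExpBounded.natCast.ite_lt 2),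
        (bc.add bn).poissonGF_add bk, bc.poissonGF_add bn,
        (conv hs hk).poissonGF_add (conv hk hs), hs.poissonGF_binomConv hpq hk,
        hk.poissonGF_binomConv hpq hs, bs.poissonGF_natCast_mul, hderiv, hsplit hm, hsplit hs,
        hsplit hk, poissonGF_ite_natCast]
      rfl

end IsTriePairFamily

/-- functional equation for the Poissonized covariance `C̃`. -/
theorem stmt10 (p : ℝ) (hp0 : 0 < p) (hp1 : p < 1) (q : ℝ) (hq : q = 1 - p)
    (μ : ℕ → Measure (ℕ × ℕ)) (hμ : IsTriePairFamily p μ)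
    (Ct h1 h2 : ℂ → ℂ)
    (hCt : ∀ z : ℂ, Ct z = pgfSK μ z - pgfS μ z * pgfK μ z
        - z * deriv (pgfS μ) z * deriv (pgfK μ) z)
    (hh1 : ∀ z : ℂ, h1 z = (p : ℂ) * (q : ℂ) * z *
        (deriv (pgfS μ) ((p : ℂ) * z) - deriv (pgfS μ) ((q : ℂ) * z)) *
        (deriv (pgfK μ) ((p : ℂ) * z) - deriv (pgfK μ) ((q : ℂ) * z)))
    (hh2 : ∀ z : ℂ, h2 z =
        z * Complex.exp (-z) * (pgfS μ ((p : ℂ) * z) + pgfS μ ((q : ℂ) * z)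
          + (p : ℂ) * (1 - z) * deriv (pgfS μ) ((p : ℂ) * z)
          + (q : ℂ) * (1 - z) * deriv (pgfS μ) ((q : ℂ) * z))
        + Complex.exp (-z) * ((1 + z) * pgfK μ ((p : ℂ) * z)
          + (1 + z) * pgfK μ ((q : ℂ) * z)
          - (p : ℂ) * z ^ 2 * deriv (pgfK μ) ((p : ℂ) * z)
          - (q : ℂ) * z ^ 2 * deriv (pgfK μ) ((q : ℂ) * z))
        + z * Complex.exp (-z) * (1 - (1 + z ^ 2) * Complex.exp (-z))) :
    ∀ z : ℂ, Ct z = Ct ((p : ℂ) * z) + Ct ((q : ℂ) * z) + h1 z + h2 z := by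
  intro z
  subst hq
  rw [hCt, hCt, hCt, hh1, hh2, hμ.pgfSK_eq hp0 hp1 z, hμ.deriv_pgfS_eq hp0 hp1 z,
    hμ.deriv_pgfK_eq hp0 hp1 z, hμ.pgfS_eq hp0 hp1 z, hμ.pgfK_eq hp0 hp1 z]
  generalize pgfS μ (p * z) = A, pgfS μ ((1 - p : ℝ) * z) = B,
    pgfK μ (p * z) = C, pgfK μ ((1 - p : ℝ) * z) = D
  push_cast
  ring
end

section
/- Let p ∈ (0,1) with p ≠ 1/2, q = 1 − p, and let (S_n, K_n)_{n≥0} be a random trie pair family with parameter p. Set μ(n) = E(S_n) and ν(n) = E(K_n), and for each n ≥ 2 let B_n be a Binomial(n, p) random variable. Then E|1 − μ(n) + μ(B_n) + μ(n − B_n)|³ / n^{3/2} → 0 and E|n − ν(n) + ν(B_n) + ν(n − B_n)|³ / (n log n)^{3/2} → 0 as n → ∞. -/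
open MeasureTheory ProbabilityTheory Filter Topology

noncomputable def binomExp (p : ℝ) (n : ℕ) (f : ℕ → ℝ) : ℝ :=
  ∑ k ∈ Finset.range (n + 1), (n.choose k : ℝ) * p ^ k * (1 - p) ^ (n - k) * f k

lemma binomExp_zero (p : ℝ) (f : ℕ → ℝ) : binomExp p 0 f = f 0 := by
  simp [binomExp]

lemma binomExp_succ (p : ℝ) (n : ℕ) (f : ℕ → ℝ) :
    binomExp p (n + 1) f =
      p * binomExp p n (fun k => f (k + 1)) + (1 - p) * binomExp p n f := by
  have key : (1 - p) * binomExp p n f =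
      ∑ k ∈ Finset.range (n + 1), (n.choose (k + 1) : ℝ) * p ^ (k + 1) * (1 - p) ^ (n - k) *
        f (k + 1) + (1 - p) ^ (n + 1) * f 0 := by
    have h := Finset.sum_range_succ'
      (fun k => (n.choose k : ℝ) * p ^ k * (1 - p) ^ (n + 1 - k) * f k) (n + 1)
    rw [Finset.sum_range_succ] at h
    simp only [Nat.choose_succ_self, Nat.cast_zero, zero_mul, add_zero, Nat.choose_zero_right,
      Nat.cast_one, pow_zero, mul_one, one_mul, Nat.sub_zero, Nat.reduceSubDiff] at h
    rw [← h, binomExp, Finset.mul_sum]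
    refine Finset.sum_congr rfl fun k hk => ?_
    have hk' : k ≤ n := by simpa [Nat.lt_succ_iff] using hk
    rw [Nat.succ_sub hk', pow_succ]
    ring
  rw [key, binomExp, binomExp, Finset.sum_range_succ', Finset.mul_sum, ← add_assoc,
    ← Finset.sum_add_distrib]
  congr 1
  · refine Finset.sum_congr rfl fun k _ => ?_
    rw [Nat.choose_succ_succ, Nat.add_sub_add_right]
    push_cast
    ring
  · simp

lemma binomExp_add (p : ℝ) (n : ℕ) (f g : ℕ → ℝ) :
    binomExp p n (fun k => f k + g k) = binomExp p n f + binomExp p n g := by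
  simp only [binomExp, mul_add, Finset.sum_add_distrib]

lemma binomExp_sub (p : ℝ) (n : ℕ) (f g : ℕ → ℝ) :
    binomExp p n (fun k => f k - g k) = binomExp p n f - binomExp p n g := by
  simp only [binomExp, mul_sub, Finset.sum_sub_distrib]

lemma binomExp_const_mul (p : ℝ) (n : ℕ) (c : ℝ) (f : ℕ → ℝ) :
    binomExp p n (fun k => c * f k) = c * binomExp p n f := by
  simp only [binomExp, Finset.mul_sum]
  exact Finset.sum_congr rfl fun k _ => by ring

lemma binomExp_const (p : ℝ) (n : ℕ) (c : ℝ) : binomExp p n (fun _ => c) = c := by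
  induction n with
  | zero => simp [binomExp_zero]
  | succ n ih => rw [binomExp_succ, ih]; ring

lemma binomWeight_nonneg {p : ℝ} (hp0 : 0 < p) (hp1 : p < 1) (n k : ℕ) :
    0 ≤ (n.choose k : ℝ) * p ^ k * (1 - p) ^ (n - k) := by
  have : 0 < 1 - p := by linarith
  positivity

lemma binomExp_mono {p : ℝ} (hp0 : 0 < p) (hp1 : p < 1) {n : ℕ} {f g : ℕ → ℝ}
    (h : ∀ k ≤ n, f k ≤ g k) : binomExp p n f ≤ binomExp p n g :=
  Finset.sum_le_sum fun k hk => mul_le_mul_of_nonneg_left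
    (h k (by simpa [Nat.lt_succ_iff] using hk)) (binomWeight_nonneg hp0 hp1 n k)

lemma abs_binomExp_le {p : ℝ} (hp0 : 0 < p) (hp1 : p < 1) (n : ℕ) (f : ℕ → ℝ) :
    |binomExp p n f| ≤ binomExp p n (fun k => |f k|) := by
  refine (Finset.abs_sum_le_sum_abs _ _).trans (le_of_eq (Finset.sum_congr rfl fun k _ => ?_))
  rw [abs_mul, abs_of_nonneg (binomWeight_nonneg hp0 hp1 n k)]

lemma binomExp_reflect (p : ℝ) (n : ℕ) (f : ℕ → ℝ) :
    binomExp p n (fun k => f (n - k)) = binomExp (1 - p) n f := by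
  unfold binomExp
  rw [← Finset.sum_range_reflect]
  refine Finset.sum_congr rfl fun k hk => ?_
  have hk' : k ≤ n := by simpa [Nat.lt_succ_iff] using hk
  have h1 : n + 1 - 1 - k = n - k := by omega
  simp only [h1, Nat.choose_symm hk', Nat.sub_sub_self hk', sub_sub_cancel]
  ring

/-- Size biasing of the binomial distribution. -/
lemma binomExp_size_bias (p : ℝ) (n : ℕ) (g : ℕ → ℝ) :
    (n + 1) * p * binomExp p n (fun k => g (k + 1)) =
      binomExp p (n + 1) (fun k => k * g k) := by
  unfold binomExp
  rw [Finset.sum_range_succ' _ (n + 1), Finset.mul_sum]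
  simp only [Nat.cast_zero, zero_mul, mul_zero, add_zero]
  refine Finset.sum_congr rfl fun k _ => ?_
  have h : ((n : ℝ) + 1) * (n.choose k : ℝ) = ((n + 1).choose (k + 1) : ℝ) * (k + 1) := by
    exact_mod_cast Nat.add_one_mul_choose_eq n k
  rw [Nat.add_sub_add_right, pow_succ]
  push_cast
  linear_combination (p ^ k * p * (1 - p) ^ (n - k) * g (k + 1)) * h

lemma binomExp_inv_succ (p : ℝ) (n : ℕ) :
    (n + 1) * p * binomExp p n (fun k => 1 / ((k : ℝ) + 1)) = 1 - (1 - p) ^ (n + 1) := by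
  have h := binomExp_size_bias p n (fun k => 1 / (k : ℝ))
  simp only [Nat.cast_add, Nat.cast_one] at h
  rw [h]
  have h1 : (fun k : ℕ => (k : ℝ) * (1 / (k : ℝ))) = fun k => 1 - if k = 0 then 1 else 0 := by
    ext k
    rcases Nat.eq_zero_or_pos k with rfl | hk
    · simp
    · have : (k : ℝ) ≠ 0 := by positivity
      simp [hk.ne', this]
  rw [h1, binomExp_sub, binomExp_const, binomExp]
  simp

lemma binomExp_single_zero_moment (p : ℝ) (n : ℕ) :
    binomExp p n (fun k => (k : ℝ) - n * p) = 0 := by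
  induction n with
  | zero => simp [binomExp_zero]
  | succ n ih =>
    have e1 : (fun k : ℕ => ((k + 1 : ℕ) : ℝ) - ((n + 1 : ℕ) : ℝ) * p) =
        fun k : ℕ => ((k : ℝ) - n * p) + (1 - p) := by ext k; push_cast; ring
    have e2 : (fun k : ℕ => (k : ℝ) - ((n + 1 : ℕ) : ℝ) * p) =
        fun k : ℕ => ((k : ℝ) - n * p) + (-p) := by ext k; push_cast; ring
    rw [binomExp_succ, e1, e2, binomExp_add, binomExp_add, ih, binomExp_const, binomExp_const]
    ring

lemma binomExp_sq_moment (p : ℝ) (n : ℕ) :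
    binomExp p n (fun k => ((k : ℝ) - n * p) ^ 2) = n * (p * (1 - p)) := by
  induction n with
  | zero => simp [binomExp_zero]
  | succ n ih =>
    have e1 : (fun k : ℕ => (((k + 1 : ℕ) : ℝ) - ((n + 1 : ℕ) : ℝ) * p) ^ 2) =
        fun k : ℕ => ((k : ℝ) - n * p) ^ 2 + (2 * (1 - p) * ((k : ℝ) - n * p) + (1 - p) ^ 2) := by
      ext k; push_cast; ring
    have e2 : (fun k : ℕ => ((k : ℝ) - ((n + 1 : ℕ) : ℝ) * p) ^ 2) =
        fun k : ℕ => ((k : ℝ) - n * p) ^ 2 + (-2 * p * ((k : ℝ) - n * p) + p ^ 2) := by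
      ext k; push_cast; ring
    rw [binomExp_succ, e1, e2]
    simp only [binomExp_add, binomExp_const_mul, binomExp_const, ih, binomExp_single_zero_moment]
    push_cast
    ring

lemma binomExp_fourth_moment_le {p : ℝ} (hp0 : 0 < p) (hp1 : p < 1) (n : ℕ) :
    binomExp p n (fun k => ((k : ℝ) - n * p) ^ 4) ≤ 3 * (n : ℝ) ^ 2 := by
  induction n with
  | zero => simp [binomExp_zero]
  | succ n ih =>
    have e : ∀ c : ℝ, (fun k : ℕ => (((k : ℝ) - n * p) + c) ^ 4) =
        fun k : ℕ => ((k : ℝ) - n * p) ^ 4 + (4 * c * ((k : ℝ) - n * p) ^ 3 +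
          (6 * c ^ 2 * ((k : ℝ) - n * p) ^ 2 + (4 * c ^ 3 * ((k : ℝ) - n * p) + c ^ 4))) := by
      intro c; ext k; ring
    have e1 : (fun k : ℕ => (((k + 1 : ℕ) : ℝ) - ((n + 1 : ℕ) : ℝ) * p) ^ 4) =
        fun k : ℕ => (((k : ℝ) - n * p) + (1 - p)) ^ 4 := by
      ext k; push_cast; ring
    have e2 : (fun k : ℕ => ((k : ℝ) - ((n + 1 : ℕ) : ℝ) * p) ^ 4) =
        fun k : ℕ => (((k : ℝ) - n * p) + (-p)) ^ 4 := by
      ext k; push_cast; ring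
    rw [binomExp_succ, e1, e2, e, e]
    simp only [binomExp_add, binomExp_const_mul, binomExp_const, binomExp_sq_moment,
      binomExp_single_zero_moment]
    have hr0 : 0 ≤ p * (1 - p) := mul_nonneg hp0.le (by linarith)
    have hr1 : p * (1 - p) ≤ 1 := by nlinarith
    have h2 : (p * (1 - p)) ^ 2 ≤ 1 := by nlinarith
    have hn : (0 : ℝ) ≤ n := Nat.cast_nonneg n
    have h3 : (n : ℝ) * (p * (1 - p)) ^ 2 ≤ n := by nlinarith
    push_cast
    have h4 : p * (1 - p) * ((1 - p) ^ 3 + p ^ 3) ≤ 1 := by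
      have : (1 - p) ^ 3 + p ^ 3 = 1 - 3 * (p * (1 - p)) := by ring
      rw [this]; nlinarith
    nlinarith

/-- Along a filter where an asymptotically harmonic function approaches its upper limit, so does
its rescaling. -/
lemma tendsto_extremal_step {p q M : ℝ} (hp : 0 < p) (hq : 0 < q) (hpq : p + q = 1) {g : ℝ → ℝ}
    (hharm : Tendsto (fun x => g x - p * g (p * x) - q * g (q * x)) atTop (𝓝 0))
    (hub : ∀ η > 0, ∀ᶠ x in atTop, g x < M + η) {l : Filter ℝ} {y : ℝ → ℝ}
    (hy : Tendsto y l atTop) (hg : Tendsto (fun x => g (y x)) l (𝓝 M)) :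
    Tendsto (fun x => g (p * y x)) l (𝓝 M) := by
  rw [Metric.tendsto_nhds]
  intro ε hε
  have hη : 0 < ε * p / 3 := by positivity
  have h1 := (Metric.tendsto_nhds.1 (hharm.comp hy)) _ hη
  have h2 := (Metric.tendsto_nhds.1 hg) _ hη
  have h3 := (hy.const_mul_atTop hq).eventually (hub _ hη)
  have h4 := (hy.const_mul_atTop hp).eventually (hub _ hε)
  filter_upwards [h1, h2, h3, h4] with x a1 a2 a3 a4
  simp only [Function.comp, Real.dist_eq, sub_zero] at a1 a2
  rw [Real.dist_eq, abs_lt]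
  rw [abs_lt] at a1 a2
  refine ⟨?_, by linarith⟩
  have h5 : q * g (q * y x) < q * (M + ε * p / 3) := mul_lt_mul_of_pos_left a3 hq
  have h6 : q * (ε * p / 3) < ε * p / 3 := by nlinarith
  have h7 : p * (M - ε) < p * g (p * y x) := by
    have : q * M = M - p * M := by rw [← eq_sub_iff_add_eq'.2 hpq |>.symm]; ring
    nlinarith
  have := lt_of_mul_lt_mul_left h7 hp.le
  linarith

lemma eventually_lt_of_asymp_harmonic {p q C : ℝ} (hp : 0 < p) (hq : 0 < q) (hpq : p + q = 1)
    {f : ℝ → ℝ} (hC : ∀ x, |f x| ≤ C)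
    (hf : Tendsto (fun x => f x - p * f (p * x) - q * f (q * x)) atTop (𝓝 0)) {ε : ℝ}
    (hε : 0 < ε) : ∀ᶠ x in atTop, f (p * x) - f (q * x) < ε := by
  set g : ℝ → ℝ := fun x => f (p * x) - f (q * x) with hg
  have hgC : ∀ x, |g x| ≤ 2 * C := fun x =>
    (abs_sub _ _).trans (by linarith [hC (p * x), hC (q * x)])
  have hharm : Tendsto (fun x => g x - p * g (p * x) - q * g (q * x)) atTop (𝓝 0) := by
    have h1 := hf.comp (tendsto_id.const_mul_atTop hp)
    have h2 := hf.comp (tendsto_id.const_mul_atTop hq)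
    have h3 := h1.sub h2
    rw [sub_zero] at h3
    refine h3.congr fun x => ?_
    simp only [Function.comp, hg, id]
    rw [show q * (p * x) = p * (q * x) by ring]
    ring
  have hbdd : IsBoundedUnder (· ≤ ·) atTop g :=
    isBoundedUnder_of ⟨2 * C, fun x => (abs_le.1 (hgC x)).2⟩
  have hbdd' : IsBoundedUnder (· ≥ ·) atTop g :=
    isBoundedUnder_of ⟨-(2 * C), fun x => (abs_le.1 (hgC x)).1⟩
  set M := limsup g atTop with hM
  have hub : ∀ η > 0, ∀ᶠ x in atTop, g x < M + η := fun η hη =>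
    eventually_lt_of_limsup_lt (by linarith) hbdd
  have hlb : ∀ η > 0, ∃ᶠ x in atTop, M - η < g x := fun η hη =>
    frequently_lt_of_lt_limsup hbdd'.isCoboundedUnder_le (by linarith)
  have hcl : MapClusterPt M atTop g := by
    rw [mapClusterPt_iff_frequently]
    intro s hs
    obtain ⟨η, hη, hs⟩ := Metric.mem_nhds_iff.1 hs
    refine ((hlb η hη).and_eventually (hub η hη)).mono fun x hx => hs ?_
    rw [Metric.mem_ball, Real.dist_eq, abs_lt]
    constructor <;> linarith [hx.1, hx.2]
  obtain ⟨U, hU, hUM⟩ := mapClusterPt_iff_ultrafilter.1 hcl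
  have hstep : ∀ i j : ℕ, Tendsto (fun x => g (p ^ i * q ^ j * x)) U (𝓝 M) := by
    have htop : ∀ i j : ℕ, Tendsto (fun x => p ^ i * q ^ j * x) U atTop := fun i j =>
      Tendsto.const_mul_atTop (by positivity) hU
    have hharm' : Tendsto (fun x => g x - q * g (q * x) - p * g (p * x)) atTop (𝓝 0) :=
      hharm.congr fun x => by ring
    intro i j
    induction i with
    | zero =>
      induction j with
      | zero => simpa using hUM
      | succ j ih =>
        refine (tendsto_extremal_step hq hp (by linarith) hharm' hub (htop 0 j) ih).congr
          fun x => ?_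
        rw [pow_succ]; ring_nf
    | succ i ih =>
      refine (tendsto_extremal_step hp hq hpq hharm hub (htop i j) ih).congr fun x => ?_
      rw [pow_succ]; ring_nf
  have htel : ∀ N : ℕ, ∀ x, ∑ i ∈ Finset.range N, g (p ^ i * q ^ (N - 1 - i) * x) =
      f (p ^ N * x) - f (q ^ N * x) := by
    intro N x
    have h := Finset.sum_range_sub (fun i => f (p ^ i * q ^ (N - i) * x)) N
    simp only [Nat.sub_self, pow_zero, mul_one, one_mul, Nat.sub_zero] at h
    rw [← h]
    refine Finset.sum_congr rfl fun i hi => ?_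
    have hi : i < N := Finset.mem_range.1 hi
    obtain ⟨m, rfl⟩ : ∃ m, N = i + 1 + m := ⟨N - i - 1, by omega⟩
    have h1 : i + 1 + m - 1 - i = m := by omega
    have h2 : i + 1 + m - i = m + 1 := by omega
    have h3 : i + 1 + m - (i + 1) = m := by omega
    rw [h1, h2, h3, hg]
    simp only [pow_succ]
    ring_nf
  have hle : ∀ N : ℕ, N * M ≤ 2 * C := by
    intro N
    have h := tendsto_finsetSum (Finset.range N) fun i _ => hstep i (N - 1 - i)
    simp only [Finset.sum_const, Finset.card_range, nsmul_eq_mul] at h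
    refine le_of_tendsto h (Eventually.of_forall fun x => ?_)
    rw [htel]
    linarith [abs_le.1 (hC (p ^ N * x)), abs_le.1 (hC (q ^ N * x))]
  have hM0 : M ≤ 0 := by
    by_contra! h
    obtain ⟨N, hN⟩ := exists_nat_gt (2 * C / M)
    rw [div_lt_iff₀ h] at hN
    linarith [hle N]
  filter_upwards [hub ε hε] with x hx
  simp only [hg] at hx
  linarith

/-- Choquet-Deny principle for asymptotically harmonic functions. -/
lemma tendsto_sub_of_asymp_harmonic {p q C : ℝ} (hp : 0 < p) (hq : 0 < q) (hpq : p + q = 1)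
    {f : ℝ → ℝ} (hC : ∀ x, |f x| ≤ C)
    (hf : Tendsto (fun x => f x - p * f (p * x) - q * f (q * x)) atTop (𝓝 0)) :
    Tendsto (fun x => f (p * x) - f (q * x)) atTop (𝓝 0) := by
  rw [Metric.tendsto_nhds]
  intro ε hε
  have hf' : Tendsto (fun x => f x - q * f (q * x) - p * f (p * x)) atTop (𝓝 0) :=
    hf.congr fun x => by ring
  filter_upwards [eventually_lt_of_asymp_harmonic hp hq hpq hC hf hε,
    eventually_lt_of_asymp_harmonic hq hp (by linarith) hC hf' hε] with x h1 h2
  rw [Real.dist_eq, sub_zero, abs_lt]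
  constructor <;> linarith

lemma integral_binomialMeasure {p : ℝ} (hp0 : 0 < p) (hp1 : p < 1) (n : ℕ) (f : ℕ → ℝ) :
    ∫ k, f k ∂binomialMeasure n p = binomExp p n f := by
  unfold binomialMeasure binomExp
  rw [integral_finsetSum_measure]
  · refine Finset.sum_congr rfl fun k _ => ?_
    rw [integral_smul_measure, integral_dirac,
      ENNReal.toReal_ofReal (binomWeight_nonneg hp0 hp1 n k), smul_eq_mul]
  · intro k _
    exact (integrable_dirac (by simp)).smul_measure ENNReal.ofReal_ne_top

lemma lintegral_split {p : ℝ} {μ : ℕ → Measure (ℕ × ℕ)} {n : ℕ}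
    {P : Measure (ℕ × ((ℕ → ℕ × ℕ) × (ℕ → ℕ × ℕ)))} [IsProbabilityMeasure P]
    (hB : P.map Prod.fst = binomialMeasure n p)
    (h1 : ∀ j, P.map (fun ω => ω.2.1 j) = μ j) (h2 : ∀ j, P.map (fun ω => ω.2.2 j) = μ j)
    (hP : P = (P.map Prod.fst).prod
          ((P.map (fun ω => ω.2.1)).prod (P.map (fun ω => ω.2.2))))
    (φ : ℕ × ℕ → ENNReal) :
    ∫⁻ ω, (φ (ω.2.1 ω.1) + φ (ω.2.2 (n - ω.1))) ∂P =
      ∫⁻ k, (∫⁻ x, φ x ∂μ k + ∫⁻ x, φ x ∂μ (n - k)) ∂binomialMeasure n p := by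
  have hφ : Measurable φ := measurable_of_countable φ
  have hm1 : Measurable fun ω : ℕ × ((ℕ → ℕ × ℕ) × (ℕ → ℕ × ℕ)) => ω.2.1 ω.1 :=
    measurable_from_prod_countable_right fun b => (measurable_pi_apply b).comp measurable_fst
  have hm2 : Measurable fun ω : ℕ × ((ℕ → ℕ × ℕ) × (ℕ → ℕ × ℕ)) => ω.2.2 (n - ω.1) :=
    measurable_from_prod_countable_right fun b => (measurable_pi_apply (n - b)).comp measurable_snd
  have hc1 : Measurable fun ω : ℕ × ((ℕ → ℕ × ℕ) × (ℕ → ℕ × ℕ)) => ω.2.1 := by fun_prop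
  have hc2 : Measurable fun ω : ℕ × ((ℕ → ℕ × ℕ) × (ℕ → ℕ × ℕ)) => ω.2.2 := by fun_prop
  have : IsProbabilityMeasure (P.map fun ω => ω.2.1) := Measure.isProbabilityMeasure_map hc1.aemeasurable
  have : IsProbabilityMeasure (P.map fun ω => ω.2.2) := Measure.isProbabilityMeasure_map hc2.aemeasurable
  have : IsProbabilityMeasure (P.map Prod.fst) := Measure.isProbabilityMeasure_map measurable_fst.aemeasurable
  have hS1 : ∀ j, ∫⁻ s, φ (s.1 j) ∂((P.map (fun ω => ω.2.1)).prod (P.map (fun ω => ω.2.2))) =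
      ∫⁻ x, φ x ∂μ j := by
    intro j
    have hj : Measurable fun s : ℕ → ℕ × ℕ => φ (s j) := hφ.comp (measurable_pi_apply j)
    rw [lintegral_prod (fun s : (ℕ → ℕ × ℕ) × (ℕ → ℕ × ℕ) => φ (s.1 j))
      (hj.comp measurable_fst).aemeasurable]
    simp only [lintegral_const, measure_univ, mul_one]
    rw [lintegral_map hj hc1, ← h1 j, lintegral_map hφ (by fun_prop)]
  have hS2 : ∀ j, ∫⁻ s, φ (s.2 j) ∂((P.map (fun ω => ω.2.1)).prod (P.map (fun ω => ω.2.2))) =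
      ∫⁻ x, φ x ∂μ j := by
    intro j
    have hj : Measurable fun s : ℕ → ℕ × ℕ => φ (s j) := hφ.comp (measurable_pi_apply j)
    rw [lintegral_prod (fun s : (ℕ → ℕ × ℕ) × (ℕ → ℕ × ℕ) => φ (s.2 j))
      (hj.comp measurable_snd).aemeasurable]
    simp only [lintegral_const, measure_univ, mul_one]
    rw [lintegral_map hj hc2, ← h2 j, lintegral_map hφ (by fun_prop)]
  rw [← hB]
  conv_lhs => rw [hP]
  rw [lintegral_prod (fun ω : ℕ × ((ℕ → ℕ × ℕ) × (ℕ → ℕ × ℕ)) =>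
    φ (ω.2.1 ω.1) + φ (ω.2.2 (n - ω.1))) ((hφ.comp hm1).add (hφ.comp hm2)).aemeasurable]
  refine lintegral_congr fun k => ?_
  have hk : Measurable fun s : (ℕ → ℕ × ℕ) × (ℕ → ℕ × ℕ) => φ (s.1 k) :=
    hφ.comp (by fun_prop : Measurable fun s : (ℕ → ℕ × ℕ) × (ℕ → ℕ × ℕ) => s.1 k)
  rw [← hS1, ← hS2]
  exact lintegral_add_left hk _

/-- The mean of an additive functional of a trie satisfies the trie recurrence. -/
lemma IsTriePairFamily.integral_recur {p : ℝ} (hp0 : 0 < p) (hp1 : p < 1)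
    {μ : ℕ → Measure (ℕ × ℕ)} (hμ : IsTriePairFamily p μ) (φ : ℕ × ℕ → ℕ)
    (hint : ∀ n, Integrable (fun x => (φ x : ℝ)) (μ n)) (n t : ℕ) (hn : 2 ≤ n)
    (hφ : ∀ ω, φ (trieStep n ω) = φ (ω.2.1 ω.1) + φ (ω.2.2 (n - ω.1)) + t) :
    ∫ x, (φ x : ℝ) ∂μ n = t + binomExp p n (fun k => ∫ x, (φ x : ℝ) ∂μ k) +
      binomExp (1 - p) n (fun k => ∫ x, (φ x : ℝ) ∂μ k) := by
  obtain ⟨P, hPp, hB, h1, h2, hP, hn⟩ := hμ.recur n hn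
  set L : ℕ → ENNReal := fun k => ∫⁻ x, (φ x : ENNReal) ∂μ k with hL
  have hφm : Measurable fun x => (φ x : ENNReal) := measurable_of_countable _
  have hLt : ∀ k, L k ≠ ⊤ := by
    intro k
    have h := (hint k).2
    rw [hasFiniteIntegral_iff_ofReal (Eventually.of_forall fun x => Nat.cast_nonneg _)] at h
    simpa [hL] using h.ne
  have heL : ∀ k, ∫ x, (φ x : ℝ) ∂μ k = (L k).toReal := by
    intro k
    rw [integral_eq_lintegral_of_nonneg_ae (Eventually.of_forall fun x => Nat.cast_nonneg _)
      (hint k).1]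
    simp [hL]
  have hst : Measurable (trieStep n) := by
    refine measurable_from_prod_countable_right fun b => ?_
    have h : Measurable fun s : (ℕ → ℕ × ℕ) × (ℕ → ℕ × ℕ) => (s.1 b, s.2 (n - b)) := by fun_prop
    exact (measurable_of_countable fun z : (ℕ × ℕ) × (ℕ × ℕ) =>
      (z.1.1 + z.2.1 + 1, z.1.2 + z.2.2 + n)).comp h
  have hLn : L n = (∫⁻ k, (L k + L (n - k)) ∂binomialMeasure n p) + t := by
    rw [← lintegral_split hB h1 h2 hP]
    simp only [hL]
    conv_lhs => rw [hn]
    rw [lintegral_map hφm hst]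
    simp only [hφ, Nat.cast_add]
    rw [lintegral_add_right _ measurable_const, lintegral_const, measure_univ, mul_one]
  have hsum : ∫⁻ k, (L k + L (n - k)) ∂binomialMeasure n p =
      ∑ k ∈ Finset.range (n + 1),
        ENNReal.ofReal ((n.choose k : ℝ) * p ^ k * (1 - p) ^ (n - k)) * (L k + L (n - k)) := by
    unfold binomialMeasure
    rw [lintegral_finsetSum_measure]
    simp
  rw [heL, hLn, hsum, ENNReal.toReal_add _ (by simp), ENNReal.toReal_sum]
  · simp only [heL]
    rw [← binomExp_reflect p n, add_assoc, ← binomExp_add, add_comm]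
    simp only [ENNReal.toReal_natCast]
    congr 1
    refine Finset.sum_congr rfl fun k _ => ?_
    rw [ENNReal.toReal_mul, ENNReal.toReal_ofReal (binomWeight_nonneg hp0 hp1 n k),
      ENNReal.toReal_add (hLt _) (hLt _)]
  · intro k _
    exact ENNReal.mul_ne_top ENNReal.ofReal_ne_top (ENNReal.add_ne_top.2 ⟨hLt _, hLt _⟩)
  · exact ENNReal.sum_ne_top.2 fun k _ =>
      ENNReal.mul_ne_top ENNReal.ofReal_ne_top (ENNReal.add_ne_top.2 ⟨hLt _, hLt _⟩)

lemma binomExp_succ_sub (p : ℝ) (n : ℕ) (f : ℕ → ℝ) :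
    binomExp p (n + 1) f - binomExp p n f = p * binomExp p n (fun k => f (k + 1) - f k) := by
  rw [binomExp_succ, binomExp_sub]; ring

lemma pow_mul_le_binomExp {p : ℝ} (hp0 : 0 < p) (hp1 : p < 1) {n : ℕ} {f : ℕ → ℝ}
    (h : ∀ k < n, 0 ≤ f k) : p ^ n * f n ≤ binomExp p n f := by
  rw [binomExp, Finset.sum_range_succ]
  simp only [Nat.choose_self, Nat.cast_one, one_mul, Nat.sub_self, pow_zero, mul_one]
  exact le_add_of_nonneg_left (Finset.sum_nonneg fun k hk =>
    mul_nonneg (binomWeight_nonneg hp0 hp1 n k) (h k (Finset.mem_range.1 hk)))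

/-- Minimum principle for supersolutions of the linear trie recurrence. -/
lemma nonneg_of_binom_super {p α β : ℝ} (hp0 : 0 < p) (hp1 : p < 1) (hα : 0 < α) (hβ : 0 < β)
    (hαβ : α + β ≤ 1) {f : ℕ → ℝ} (h0 : 0 ≤ f 0)
    (h : ∀ n, 1 ≤ n → α * binomExp p n f + β * binomExp (1 - p) n f ≤ f n) (n : ℕ) :
    0 ≤ f n := by
  induction n using Nat.strong_induction_on with
  | _ n ih =>
    rcases Nat.eq_zero_or_pos n with rfl | hn
    · exact h0
    have h1 := mul_le_mul_of_nonneg_left (pow_mul_le_binomExp hp0 hp1 ih) hα.le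
    have h2 := mul_le_mul_of_nonneg_left
      (pow_mul_le_binomExp (p := 1 - p) (by linarith) (by linarith) ih) hβ.le
    have h3 := h n hn
    have h4 : α * p ^ n < α := by
      have := pow_lt_one₀ hp0.le hp1 hn.ne'
      nlinarith
    have h5 : β * (1 - p) ^ n < β := by
      have := pow_lt_one₀ (by linarith : 0 ≤ 1 - p) (by linarith) hn.ne'
      nlinarith
    by_contra! hneg
    nlinarith

lemma le_div_of_binom_recur {p : ℝ} (hp0 : 0 < p) (hp1 : p < 1) {e s : ℕ → ℝ}
    (hs : ∀ n, 2 ≤ n → s n = 0)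
    (he : ∀ n, e n = s n + p ^ 2 * binomExp p n e + (1 - p) ^ 2 * binomExp (1 - p) n e)
    {C : ℝ} (hC0 : |e 0| ≤ C) (hC1 : 2 * |s 1| ≤ C * (p * (1 - p))) (n : ℕ) :
    e n ≤ C / (n + 1) := by
  have hq0 : 0 < 1 - p := by linarith
  have hC : 0 ≤ C := (abs_nonneg _).trans hC0
  have h := nonneg_of_binom_super hp0 hp1 (α := p ^ 2) (β := (1 - p) ^ 2) (by positivity)
    (by positivity) (by nlinarith) (f := fun n => C * (1 / ((n : ℝ) + 1)) - e n)
    (by have := le_abs_self (e 0); norm_num; linarith) ?_ n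
  · replace h : 0 ≤ C * (1 / ((n : ℝ) + 1)) - e n := h
    rw [mul_one_div] at h
    linarith
  intro n hn
  have hn1 : (0 : ℝ) < n + 1 := by positivity
  rw [binomExp_sub, binomExp_sub, binomExp_const_mul, binomExp_const_mul]
  have h1 := binomExp_inv_succ p n
  have h2 := binomExp_inv_succ (1 - p) n
  rw [sub_sub_cancel] at h2
  have h3 : p * binomExp p n (fun k => 1 / ((k : ℝ) + 1)) =
      (1 - (1 - p) ^ (n + 1)) / (n + 1) := by
    rw [← h1]; field_simp
  have h4 : (1 - p) * binomExp (1 - p) n (fun k => 1 / ((k : ℝ) + 1)) =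
      (1 - p ^ (n + 1)) / (n + 1) := by
    rw [← h2]; field_simp
  have h5 : p ^ 2 * (C * binomExp p n (fun k => 1 / ((k : ℝ) + 1)) - binomExp p n e) +
      (1 - p) ^ 2 * (C * binomExp (1 - p) n (fun k => 1 / ((k : ℝ) + 1)) -
        binomExp (1 - p) n e) =
      C * (1 / (n + 1)) - e n + s n -
        C * (p * (1 - p) * ((1 - p) ^ n + p ^ n)) / (n + 1) := by
    have h6 := he n
    have h7 : C * (p * (p * binomExp p n (fun k => 1 / ((k : ℝ) + 1))) +
        (1 - p) * ((1 - p) * binomExp (1 - p) n (fun k => 1 / ((k : ℝ) + 1)))) =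
        C * (1 / (n + 1)) - C * (p * (1 - p) * ((1 - p) ^ n + p ^ n)) / (n + 1) := by
      rw [h3, h4, pow_succ, pow_succ]; field_simp; ring
    linear_combination h7 + h6
  rw [h5]
  rcases eq_or_lt_of_le hn with rfl | hn
  · have := le_abs_self (s 1)
    norm_num
    nlinarith
  · rw [hs n hn]
    have : 0 ≤ C * (p * (1 - p) * ((1 - p) ^ n + p ^ n)) / (n + 1) := by positivity
    linarith

lemma abs_le_div_of_binom_recur {p : ℝ} (hp0 : 0 < p) (hp1 : p < 1) {e s : ℕ → ℝ}
    (hs : ∀ n, 2 ≤ n → s n = 0)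
    (he : ∀ n, e n = s n + p ^ 2 * binomExp p n e + (1 - p) ^ 2 * binomExp (1 - p) n e) :
    ∃ C, 0 ≤ C ∧ ∀ n : ℕ, |e n| ≤ C / (n + 1) := by
  have hr : 0 < p * (1 - p) := mul_pos hp0 (by linarith)
  have hC1 : 2 * |s 1| ≤ (|e 0| + 2 * |s 1| / (p * (1 - p))) * (p * (1 - p)) := by
    rw [add_mul, div_mul_cancel₀ _ hr.ne']
    have := mul_nonneg (abs_nonneg (e 0)) hr.le
    linarith
  have hC0 : |e 0| ≤ |e 0| + 2 * |s 1| / (p * (1 - p)) := by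
    have : 0 ≤ 2 * |s 1| / (p * (1 - p)) := by positivity
    linarith
  refine ⟨|e 0| + 2 * |s 1| / (p * (1 - p)), by positivity, fun n => abs_le'.2 ⟨?_, ?_⟩⟩
  · exact le_div_of_binom_recur hp0 hp1 hs he hC0 hC1 n
  · refine le_div_of_binom_recur hp0 hp1 (e := fun n => -e n) (s := fun n => -s n)
      (fun n hn => by simp [hs n hn]) (fun n => ?_) (by simpa using hC0) (by simpa using hC1) n
    have h : ∀ r : ℝ, binomExp r n (fun k => -e k) = -binomExp r n e := fun r => by
      simpa using binomExp_const_mul r n (-1) e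
    rw [h, h, he n]
    ring

lemma binom_recur_diff {p c₁ c₂ : ℝ} {a t : ℕ → ℝ}
    (ha : ∀ n, a n = t n + c₁ * binomExp p n a + c₂ * binomExp (1 - p) n a) (n : ℕ) :
    a (n + 1) - a n = t (n + 1) - t n + c₁ * p * binomExp p n (fun k => a (k + 1) - a k) +
      c₂ * (1 - p) * binomExp (1 - p) n (fun k => a (k + 1) - a k) := by
  linear_combination ha (n + 1) - ha n + c₁ * binomExp_succ_sub p n a +
    c₂ * binomExp_succ_sub (1 - p) n a

lemma exists_second_diff_bound {p : ℝ} (hp0 : 0 < p) (hp1 : p < 1) {a t : ℕ → ℝ}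
    (ha : ∀ n, a n = t n + binomExp p n a + binomExp (1 - p) n a)
    (ht : ∀ n, 2 ≤ n → t (n + 2) - t (n + 1) = t (n + 1) - t n) :
    ∃ C, 0 ≤ C ∧ ∀ n : ℕ, |(a (n + 2) - a (n + 1)) - (a (n + 1) - a n)| ≤ C / (n + 1) := by
  have h1 := binom_recur_diff (p := p) (c₁ := 1) (c₂ := 1) (a := a) (t := t)
    (fun n => by rw [one_mul, one_mul]; exact ha n)
  have h2 := binom_recur_diff (p := p) (a := fun n => a (n + 1) - a n)
    (t := fun n => t (n + 1) - t n) h1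
  simp only [one_mul, ← pow_two] at h2
  exact abs_le_div_of_binom_recur hp0 hp1
    (s := fun n => (t (n + 2) - t (n + 1)) - (t (n + 1) - t n))
    (fun n hn => by simp [ht n hn]) h2

lemma exists_diff_bound {p : ℝ} (hp0 : 0 < p) (hp1 : p < 1) {d s : ℕ → ℝ} (h0 : d 0 = 0)
    (hs : ∀ n, 2 ≤ n → s n = 0)
    (hd : ∀ n, d n = s n + p * binomExp p n d + (1 - p) * binomExp (1 - p) n d) :
    ∃ C, 0 ≤ C ∧ ∀ n : ℕ, |d n| ≤ C := by
  have hq0 : 0 < 1 - p := by linarith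
  have hr : 0 < p * (1 - p) := mul_pos hp0 hq0
  set C := |s 1| / (p * (1 - p)) with hCdef
  have hC : 0 ≤ C := by positivity
  have hCs : C * (p * (1 - p)) = |s 1| := div_mul_cancel₀ _ hr.ne'
  have key : ∀ σ : ℝ, |σ| = 1 → ∀ n, σ * d n ≤ C := by
    intro σ hσ n
    have h := nonneg_of_binom_super hp0 hp1 hp0 hq0 (by linarith)
      (f := fun n => (C - C * (1 / ((n : ℝ) + 1))) - σ * d n) (by simp [h0]) ?_ n
    · have h' : 0 ≤ C * (1 / ((n : ℝ) + 1)) := by positivity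
      linarith
    intro n hn
    have hn1 : (0 : ℝ) < n + 1 := by positivity
    simp only [binomExp_sub, binomExp_const_mul, binomExp_const]
    have h1 := binomExp_inv_succ p n
    have h2 := binomExp_inv_succ (1 - p) n
    rw [sub_sub_cancel] at h2
    have h3 : p * binomExp p n (fun k => 1 / ((k : ℝ) + 1)) =
        (1 - (1 - p) ^ (n + 1)) / (n + 1) := by
      rw [← h1]; field_simp
    have h4 : (1 - p) * binomExp (1 - p) n (fun k => 1 / ((k : ℝ) + 1)) =
        (1 - p ^ (n + 1)) / (n + 1) := by
      rw [← h2]; field_simp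
    have h5 : p * (C - C * binomExp p n (fun k => 1 / ((k : ℝ) + 1)) - σ * binomExp p n d) +
        (1 - p) * (C - C * binomExp (1 - p) n (fun k => 1 / ((k : ℝ) + 1)) -
          σ * binomExp (1 - p) n d) =
        (C - C * (1 / (n + 1))) - σ * d n + σ * s n -
          C * ((1 - p ^ (n + 1) - (1 - p) ^ (n + 1)) / (n + 1)) := by
      have h7 : (1 - (1 - p) ^ (n + 1)) / (n + 1) + (1 - p ^ (n + 1)) / (n + 1) =
          1 / ((n : ℝ) + 1) + (1 - p ^ (n + 1) - (1 - p) ^ (n + 1)) / (n + 1) := by ring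
      linear_combination σ * hd n - C * h3 - C * h4 - C * h7
    rw [h5]
    rcases eq_or_lt_of_le hn with rfl | hn
    · have h6 : σ * s 1 ≤ |s 1| := by
        calc σ * s 1 ≤ |σ * s 1| := le_abs_self _
          _ = |s 1| := by rw [abs_mul, hσ, one_mul]
      norm_num
      nlinarith
    · rw [hs n hn]
      have h8 : p ^ (n + 1) ≤ p := pow_le_of_le_one hp0.le hp1.le (by omega)
      have h9 : (1 - p) ^ (n + 1) ≤ 1 - p := pow_le_of_le_one hq0.le (by linarith) (by omega)
      have : 0 ≤ C * ((1 - p ^ (n + 1) - (1 - p) ^ (n + 1)) / (n + 1)) :=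
        mul_nonneg hC (div_nonneg (by linarith) hn1.le)
      linarith
  refine ⟨C, hC, fun n => abs_le'.2 ⟨?_, ?_⟩⟩
  · simpa using key 1 (by simp) n
  · simpa using key (-1) (by simp) n

lemma abs_sub_le_of_diff_le {d : ℕ → ℝ} {C : ℝ} (hC : 0 ≤ C)
    (hd : ∀ i : ℕ, |d (i + 1) - d i| ≤ C / (i + 1)) {j k : ℕ} (hjk : j ≤ k) :
    |d k - d j| ≤ C * (k - j) / (j + 1) := by
  induction k, hjk using Nat.le_induction with
  | base => simp
  | succ k hk ih =>
    have h1 : (j : ℝ) ≤ k := by exact_mod_cast hk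
    have h2 : C / ((k : ℝ) + 1) ≤ C / (j + 1) := by gcongr
    have h3 : C * (((k + 1 : ℕ) : ℝ) - j) / (j + 1) = C * ((k : ℝ) - j) / (j + 1) + C / (j + 1) := by
      push_cast; ring
    calc |d (k + 1) - d j| = |(d (k + 1) - d k) + (d k - d j)| := by ring_nf
      _ ≤ |d (k + 1) - d k| + |d k - d j| := abs_add_le _ _
      _ ≤ _ := by rw [h3]; linarith [hd k]

lemma abs_sub_le_of_diff_le_of_osc {d : ℕ → ℝ} {C L : ℝ} (hC : 0 ≤ C)
    (hd : ∀ i : ℕ, |d (i + 1) - d i| ≤ C / (i + 1)) (hCL : C ≤ L) {j k : ℕ}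
    (hL : |d k - d j| ≤ L) : |d k - d j| ≤ 2 * L * |(k : ℝ) - j| / (j + 1) := by
  have hj : (0 : ℝ) < j + 1 := by positivity
  have hL0 : 0 ≤ L := hC.trans hCL
  rcases le_total j k with h | h
  · have h' : (j : ℝ) ≤ k := by exact_mod_cast h
    refine (abs_sub_le_of_diff_le hC hd h).trans ?_
    rw [abs_of_nonneg (sub_nonneg.2 h')]
    have : 0 ≤ (k : ℝ) - j := sub_nonneg.2 h'
    gcongr
    linarith
  · have h' : (k : ℝ) ≤ j := by exact_mod_cast h
    rw [abs_of_nonpos (sub_nonpos.2 h'), neg_sub]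
    rcases le_total ((j : ℝ) + 1) (2 * (j - k)) with h2 | h2
    · refine hL.trans ?_
      rw [le_div_iff₀ hj]
      nlinarith
    · have h3 := abs_sub_le_of_diff_le hC hd h
      rw [abs_sub_comm]
      refine h3.trans ?_
      rw [div_le_div_iff₀ (by positivity) hj]
      have h0 : 0 ≤ (j : ℝ) - k := sub_nonneg.2 h'
      have h4 : (j : ℝ) + 1 ≤ 2 * (k + 1) := by linarith
      calc C * ((j : ℝ) - k) * (j + 1) ≤ L * ((j : ℝ) - k) * (2 * (k + 1)) := by gcongr
        _ = _ := by ring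

lemma binomExp_abs_moments {p : ℝ} (hp0 : 0 < p) (hp1 : p < 1) {n : ℕ} (hn : 1 ≤ n) {c : ℝ}
    (hc : |n * p - c| ≤ 1) :
    binomExp p n (fun k => |(k : ℝ) - c|) ≤ 3 * √n ∧
    binomExp p n (fun k => |(k : ℝ) - c| ^ 3) ≤ 18 * (n * √n) ∧
    binomExp p n (fun k => |(k : ℝ) - c| ^ 4) ≤ 32 * (n : ℝ) ^ 2 := by
  have hn1 : (1 : ℝ) ≤ n := by exact_mod_cast hn
  set s := √(n : ℝ) with hs
  have hs0 : 0 < s := Real.sqrt_pos.2 (by linarith)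
  have hss : s * s = n := Real.mul_self_sqrt (by linarith)
  have hc2 : (n * p - c) ^ 2 ≤ 1 := by
    rw [← sq_abs]; nlinarith [abs_nonneg (n * p - c)]
  have hr : p * (1 - p) ≤ 1 := by nlinarith
  have hsq : ∀ k : ℕ, |(k : ℝ) - c| ^ 2 ≤ 2 * ((k : ℝ) - n * p) ^ 2 + 2 := by
    intro k
    rw [sq_abs]
    nlinarith [sq_nonneg (((k : ℝ) - n * p) - (n * p - c))]
  have h2 : binomExp p n (fun k => |(k : ℝ) - c| ^ 2) ≤ 4 * n := by
    refine (binomExp_mono hp0 hp1 fun k _ => hsq k).trans ?_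
    rw [binomExp_add, binomExp_const_mul, binomExp_const, binomExp_sq_moment]
    nlinarith
  have h4 : binomExp p n (fun k => |(k : ℝ) - c| ^ 4) ≤ 32 * (n : ℝ) ^ 2 := by
    have : ∀ k ≤ n, |(k : ℝ) - c| ^ 4 ≤ 8 * ((k : ℝ) - n * p) ^ 4 + 8 := by
      intro k _
      calc |(k : ℝ) - c| ^ 4 = (|(k : ℝ) - c| ^ 2) ^ 2 := by ring
        _ ≤ (2 * ((k : ℝ) - n * p) ^ 2 + 2) ^ 2 := pow_le_pow_left₀ (by positivity) (hsq k) 2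
        _ ≤ _ := by nlinarith [sq_nonneg (((k : ℝ) - n * p) ^ 2 - 1)]
    refine (binomExp_mono hp0 hp1 this).trans ?_
    rw [binomExp_add, binomExp_const_mul, binomExp_const]
    nlinarith [binomExp_fourth_moment_le hp0 hp1 n]
  refine ⟨?_, ?_, h4⟩
  · have : ∀ k ≤ n, |(k : ℝ) - c| ≤ s / 2 + (1 / (2 * s)) * |(k : ℝ) - c| ^ 2 := by
      intro k _
      have : s / 2 + (1 / (2 * s)) * |(k : ℝ) - c| ^ 2 - |(k : ℝ) - c| =
          (s - |(k : ℝ) - c|) ^ 2 / (2 * s) := by field_simp; ring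
      have : 0 ≤ (s - |(k : ℝ) - c|) ^ 2 / (2 * s) := by positivity
      linarith
    refine (binomExp_mono hp0 hp1 this).trans ?_
    rw [binomExp_add, binomExp_const_mul, binomExp_const]
    calc s / 2 + 1 / (2 * s) * binomExp p n (fun k => |(k : ℝ) - c| ^ 2)
        ≤ s / 2 + 1 / (2 * s) * (4 * n) := by gcongr
      _ = s / 2 + 2 * s := by rw [← hss]; field_simp; ring
      _ ≤ 3 * s := by linarith
  · have : ∀ k ≤ n, |(k : ℝ) - c| ^ 3 ≤
        s / 2 * |(k : ℝ) - c| ^ 2 + (1 / (2 * s)) * |(k : ℝ) - c| ^ 4 := by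
      intro k _
      have : s / 2 * |(k : ℝ) - c| ^ 2 + (1 / (2 * s)) * |(k : ℝ) - c| ^ 4 - |(k : ℝ) - c| ^ 3 =
          |(k : ℝ) - c| ^ 2 * (s - |(k : ℝ) - c|) ^ 2 / (2 * s) := by field_simp; ring
      have : 0 ≤ |(k : ℝ) - c| ^ 2 * (s - |(k : ℝ) - c|) ^ 2 / (2 * s) := by positivity
      linarith
    refine (binomExp_mono hp0 hp1 this).trans ?_
    rw [binomExp_add, binomExp_const_mul, binomExp_const_mul]
    calc s / 2 * binomExp p n (fun k => |(k : ℝ) - c| ^ 2) +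
          1 / (2 * s) * binomExp p n (fun k => |(k : ℝ) - c| ^ 4)
        ≤ s / 2 * (4 * n) + 1 / (2 * s) * (32 * n ^ 2) := by gcongr
      _ = 18 * (n * s) := by rw [← hss]; field_simp; ring

lemma abs_binomExp_pow_three_le {p : ℝ} (hp0 : 0 < p) (hp1 : p < 1) (n : ℕ) (f : ℕ → ℝ) :
    |binomExp p n f| ^ 3 ≤ binomExp p n (fun k => |f k| ^ 3) := by
  refine (pow_le_pow_left₀ (abs_nonneg _) (abs_binomExp_le hp0 hp1 n f) 3).trans ?_
  refine Real.pow_arith_mean_le_arith_mean_pow _ _ _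
    (fun k _ => binomWeight_nonneg hp0 hp1 n k) ?_ (fun k _ => abs_nonneg _) 3
  simpa [binomExp] using binomExp_const p n 1

lemma add_pow_three_le {a b : ℝ} (ha : 0 ≤ a) (hb : 0 ≤ b) :
    (a + b) ^ 3 ≤ 4 * (a ^ 3 + b ^ 3) := by
  have := add_pow_le ha hb 3
  norm_num at this
  linarith

/-- Centering a function at its binomial mean costs at most a factor in third absolute moments. -/
lemma binomExp_abs_pow_three_le_of_mean_zero {p : ℝ} (hp0 : 0 < p) (hp1 : p < 1) {n : ℕ}
    {f : ℕ → ℝ} (hf : binomExp p n f = 0) (c : ℝ) :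
    binomExp p n (fun k => |f k| ^ 3) ≤ 8 * binomExp p n (fun k => |f k - c| ^ 3) := by
  have h1 : |c| ^ 3 ≤ binomExp p n (fun k => |f k - c| ^ 3) := by
    have := abs_binomExp_pow_three_le hp0 hp1 n (fun k => f k - c)
    rwa [binomExp_sub, hf, binomExp_const, zero_sub, abs_neg] at this
  have h2 : ∀ k ≤ n, |f k| ^ 3 ≤ 4 * |f k - c| ^ 3 + 4 * |c| ^ 3 := by
    intro k _
    have h : |f k| ≤ |f k - c| + |c| := by simpa using abs_add_le (f k - c) c
    have := add_pow_three_le (abs_nonneg (f k - c)) (abs_nonneg c)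
    linarith [pow_le_pow_left₀ (abs_nonneg _) h 3]
  refine (binomExp_mono hp0 hp1 h2).trans ?_
  rw [binomExp_add, binomExp_const_mul, binomExp_const]
  linarith

lemma abs_sub_le_of_step_le {D : ℕ → ℝ} {n j : ℕ} {ε M : ℝ} (hM : 0 ≤ M) (hj : j ≤ n)
    (hstep : ∀ i, i + 1 ≤ n → |D (i + 1) - D i| ≤ ε + M * |(i : ℝ) - j|) {k : ℕ} (hk : k ≤ n) :
    |D k - D j| ≤ |(k : ℝ) - j| * (ε + M * |(k : ℝ) - j|) := by
  have hup : ∀ m : ℕ, j + m ≤ n → |D (j + m) - D j| ≤ m * (ε + M * m) := by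
    intro m
    induction m with
    | zero => simp
    | succ m ih =>
      intro h
      have h1 := ih (by omega)
      have h2 := hstep (j + m) (by omega)
      have h3 : |((j + m : ℕ) : ℝ) - j| = m := by push_cast; simp
      rw [h3] at h2
      have h4 : |D (j + (m + 1)) - D j| ≤ |D (j + m + 1) - D (j + m)| + |D (j + m) - D j| := by
        simpa [add_assoc] using abs_add_le (D (j + m + 1) - D (j + m)) (D (j + m) - D j)
      push_cast
      nlinarith [mul_nonneg hM (Nat.cast_nonneg (α := ℝ) m)]
  have hdown : ∀ m : ℕ, m ≤ j → |D (j - m) - D j| ≤ m * (ε + M * m) := by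
    intro m
    induction m with
    | zero => simp
    | succ m ih =>
      intro h
      have h1 := ih (by omega)
      have h2 := hstep (j - (m + 1)) (by omega)
      have h3 : |((j - (m + 1) : ℕ) : ℝ) - j| = m + 1 := by
        rw [Nat.cast_sub h, abs_of_nonpos (by push_cast; linarith [Nat.cast_nonneg (α := ℝ) m])]
        push_cast; ring
      rw [h3, show j - (m + 1) + 1 = j - m by omega, abs_sub_comm] at h2
      have h4 : |D (j - (m + 1)) - D j| ≤ |D (j - (m + 1)) - D (j - m)| + |D (j - m) - D j| := by
        simpa using abs_add_le (D (j - (m + 1)) - D (j - m)) (D (j - m) - D j)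
      push_cast
      nlinarith [mul_nonneg hM (Nat.cast_nonneg (α := ℝ) m)]
  rcases le_total j k with h | h
  · obtain ⟨m, rfl⟩ := Nat.exists_eq_add_of_le h
    have h3 : |((j + m : ℕ) : ℝ) - j| = m := by push_cast; simp
    rw [h3]
    exact hup m hk
  · obtain ⟨m, rfl⟩ := Nat.exists_eq_add_of_le h
    have h3 : |(k : ℝ) - ((k + m : ℕ) : ℝ)| = m := by push_cast; simp
    rw [h3]
    simpa using hdown m (by omega)

lemma floor_mul_bounds {p : ℝ} (hp0 : 0 < p) (hp1 : p < 1) {n : ℕ} (hn : 1 ≤ n) :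
    ⌊p * n⌋₊ < n ∧ |n * p - (⌊p * n⌋₊ : ℝ)| ≤ 1 ∧ p * n ≤ (⌊p * n⌋₊ : ℝ) + 1 ∧
      (1 - p) * n ≤ ((n - 1 - ⌊p * n⌋₊ : ℕ) : ℝ) + 1 := by
  have hn1 : (1 : ℝ) ≤ n := by exact_mod_cast hn
  have h0 : 0 ≤ p * n := by positivity
  have h1 := Nat.floor_le h0
  have h2 := (Nat.lt_floor_add_one (p * n)).le
  have h3 : ⌊p * n⌋₊ < n := by
    have : (⌊p * n⌋₊ : ℝ) < n := by nlinarith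
    exact_mod_cast this
  refine ⟨h3, abs_le.2 ⟨by linarith, by linarith⟩, h2, ?_⟩
  rw [Nat.cast_sub (by omega), Nat.cast_sub hn]
  push_cast
  linarith

/-- Third-moment bound for the toll of a binomial splitting recurrence with slowly varying
increments. -/
lemma binomExp_toll_pow_three_le {p : ℝ} (hp0 : 0 < p) (hp1 : p < 1) {a : ℕ → ℝ} {n : ℕ}
    (hn : 1 ≤ n) {T L ε : ℝ} (hL : 0 ≤ L)
    (hrec : a n = T + binomExp p n a + binomExp (1 - p) n a)
    (hlip : ∀ i k, i ≤ n → k ≤ n → |(a (k + 1) - a k) - (a (i + 1) - a i)| ≤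
      2 * L * |(k : ℝ) - i| / (i + 1))
    (hε : |(a (⌊p * n⌋₊ + 1) - a ⌊p * n⌋₊) -
      (a (n - 1 - ⌊p * n⌋₊ + 1) - a (n - 1 - ⌊p * n⌋₊))| ≤ ε) :
    binomExp p n (fun k => |T - a n + a k + a (n - k)| ^ 3) ≤
      576 * ε ^ 3 * (n * √n) + 1024 * (2 * L / (p * (1 - p))) ^ 3 * n := by
  obtain ⟨hjn, hj1, hjp, hjq⟩ := floor_mul_bounds hp0 hp1 hn
  set j := ⌊p * n⌋₊ with hjdef
  have hq0 : 0 < 1 - p := by linarith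
  have hn0 : (0 : ℝ) < n := by exact_mod_cast hn
  have hε0 : 0 ≤ ε := (abs_nonneg _).trans hε
  set M := 2 * L / (p * (1 - p)) with hM
  have hM0 : 0 ≤ M := by positivity
  set D : ℕ → ℝ := fun k => T - a n + a k + a (n - k) with hD
  have hmean : binomExp p n D = 0 := by
    rw [hD, binomExp_add, binomExp_add, binomExp_const, binomExp_reflect, hrec]
    ring
  have hstep : ∀ i, i + 1 ≤ n → |D (i + 1) - D i| ≤ ε + M / n * |(i : ℝ) - j| := by
    intro i hi
    have e1 : D (i + 1) - D i = ((a (i + 1) - a i) - (a (j + 1) - a j)) +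
        ((a (j + 1) - a j) - (a (n - 1 - j + 1) - a (n - 1 - j))) -
        ((a (n - 1 - i + 1) - a (n - 1 - i)) - (a (n - 1 - j + 1) - a (n - 1 - j))) := by
      simp only [hD]
      rw [show n - 1 - i + 1 = n - i by omega, show n - (i + 1) = n - 1 - i by omega]
      ring
    have h1 := hlip j i (by omega) (by omega)
    have h2 := hlip (n - 1 - j) (n - 1 - i) (by omega) (by omega)
    have e2 : |((n - 1 - i : ℕ) : ℝ) - ((n - 1 - j : ℕ) : ℝ)| = |(i : ℝ) - j| := by
      rw [Nat.cast_sub (show i ≤ n - 1 by omega), Nat.cast_sub (show j ≤ n - 1 by omega),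
        abs_sub_comm]
      congr 1; ring
    rw [e2] at h2
    have h3 : 2 * L * |(i : ℝ) - j| / (j + 1) ≤ 2 * L * |(i : ℝ) - j| / (p * n) := by gcongr
    have h4 : 2 * L * |(i : ℝ) - j| / (((n - 1 - j : ℕ) : ℝ) + 1) ≤
        2 * L * |(i : ℝ) - j| / ((1 - p) * n) := by gcongr
    have e3 : 2 * L * |(i : ℝ) - j| / (p * n) + 2 * L * |(i : ℝ) - j| / ((1 - p) * n) =
        M / n * |(i : ℝ) - j| := by
      rw [hM]; field_simp; ring
    rw [e1]
    refine (abs_sub _ _).trans ?_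
    have := abs_add_le ((a (i + 1) - a i) - (a (j + 1) - a j))
      ((a (j + 1) - a j) - (a (n - 1 - j + 1) - a (n - 1 - j)))
    linarith
  have hcube : ∀ k ≤ n, |D k - D j| ^ 3 ≤
      4 * ε ^ 3 * |(k : ℝ) - j| ^ 3 + 4 * M ^ 3 / n * |(k : ℝ) - j| ^ 4 := by
    intro k hk
    have h1 := abs_sub_le_of_step_le (by positivity : 0 ≤ M / n) hjn.le hstep hk
    set x := |(k : ℝ) - j| with hx
    have hx0 : 0 ≤ x := abs_nonneg _
    have hxn : x ≤ n := by
      have : (k : ℝ) ≤ n := by exact_mod_cast hk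
      have : (j : ℝ) ≤ n := by exact_mod_cast hjn.le
      exact abs_le.2 ⟨by linarith [Nat.cast_nonneg (α := ℝ) k], by
        linarith [Nat.cast_nonneg (α := ℝ) j]⟩
    have hy1 : x / n ≤ 1 := div_le_one_of_le₀ hxn hn0.le
    have hy0 : 0 ≤ x / n := by positivity
    have hy3 : (x / n) ^ 3 ≤ x / n := pow_le_of_le_one hy0 hy1 (by norm_num)
    calc |D k - D j| ^ 3 ≤ (x * (ε + M / n * x)) ^ 3 := pow_le_pow_left₀ (abs_nonneg _) h1 3
      _ = x ^ 3 * (ε + M * (x / n)) ^ 3 := by ring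
      _ ≤ x ^ 3 * (4 * (ε ^ 3 + (M * (x / n)) ^ 3)) := by
          gcongr; exact add_pow_three_le hε0 (by positivity)
      _ = x ^ 3 * (4 * (ε ^ 3 + M ^ 3 * (x / n) ^ 3)) := by ring
      _ ≤ x ^ 3 * (4 * (ε ^ 3 + M ^ 3 * (x / n))) := by gcongr
      _ = _ := by ring
  obtain ⟨-, h3, h4⟩ := binomExp_abs_moments hp0 hp1 hn hj1
  refine (binomExp_abs_pow_three_le_of_mean_zero hp0 hp1 hmean (D j)).trans ?_
  have h5 := binomExp_mono hp0 hp1 hcube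
  rw [binomExp_add, binomExp_const_mul, binomExp_const_mul] at h5
  have h6 := mul_le_mul_of_nonneg_left h3 (by positivity : 0 ≤ 4 * ε ^ 3)
  have h7 := mul_le_mul_of_nonneg_left h4 (by positivity : 0 ≤ 4 * M ^ 3 / n)
  have e : 4 * M ^ 3 / n * (32 * (n : ℝ) ^ 2) = 128 * M ^ 3 * n := by field_simp; ring
  rw [e] at h7
  linarith

lemma tendsto_binomExp_sub_floor {r L : ℝ} (hr0 : 0 < r) (hr1 : r < 1) {d : ℕ → ℝ} (hL : 0 ≤ L)
    (hlip : ∀ i k : ℕ, |d k - d i| ≤ 2 * L * |(k : ℝ) - i| / (i + 1)) :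
    Tendsto (fun x : ℝ => binomExp r ⌊x⌋₊ d - d ⌊r * x⌋₊) atTop (𝓝 0) := by
  have hlim : Tendsto (fun x : ℝ => 6 * L / r / √(⌊x⌋₊ : ℝ)) atTop (𝓝 0) :=
    Tendsto.div_atTop tendsto_const_nhds (Real.tendsto_sqrt_atTop.comp
      (tendsto_natCast_atTop_atTop.comp tendsto_nat_floor_atTop))
  refine squeeze_zero_norm' ?_ hlim
  filter_upwards [eventually_ge_atTop 1] with x hx
  have hn : 1 ≤ ⌊x⌋₊ := (Nat.one_le_floor_iff x).2 hx
  have hn1 : (1 : ℝ) ≤ ⌊x⌋₊ := by exact_mod_cast hn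
  set n := ⌊x⌋₊ with hndef
  set j := ⌊r * x⌋₊ with hj
  have hnx : (n : ℝ) ≤ x := Nat.floor_le (by linarith)
  have hxn : x < n + 1 := Nat.lt_floor_add_one x
  have hj1 : (j : ℝ) ≤ r * x := Nat.floor_le (by positivity)
  have hj2 : r * x < j + 1 := Nat.lt_floor_add_one _
  have hc : |n * r - (j : ℝ)| ≤ 1 := abs_le.2 ⟨by nlinarith, by nlinarith⟩
  have hs0 : 0 < √(n : ℝ) := Real.sqrt_pos.2 (by linarith)
  have hss : √(n : ℝ) * √(n : ℝ) = n := Real.mul_self_sqrt (by linarith)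
  have h1 := (binomExp_abs_moments hr0 hr1 hn hc).1
  have h2 : binomExp r n d - d j = binomExp r n (fun k => d k - d j) := by
    rw [binomExp_sub, binomExp_const]
  have h0 : 0 ≤ binomExp r n (fun k => |(k : ℝ) - j|) := by
    rw [← binomExp_const r n 0]
    exact binomExp_mono hr0 hr1 fun k _ => abs_nonneg _
  rw [h2, Real.norm_eq_abs]
  calc |binomExp r n (fun k => d k - d j)|
      ≤ binomExp r n (fun k => |d k - d j|) := abs_binomExp_le hr0 hr1 n _
    _ ≤ binomExp r n (fun k => 2 * L / (j + 1) * |(k : ℝ) - j|) :=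
        binomExp_mono hr0 hr1 fun k _ => (hlip j k).trans (le_of_eq (by ring))
    _ = 2 * L / (j + 1) * binomExp r n (fun k => |(k : ℝ) - j|) := binomExp_const_mul _ _ _ _
    _ ≤ 2 * L / (r * n) * (3 * √n) := by
        have : r * n ≤ j + 1 := by nlinarith
        exact mul_le_mul (by gcongr) h1 h0 (by positivity)
    _ = 6 * L / r / √(n : ℝ) := by
        have h : ∀ s m : ℝ, 0 < s → s * s = m → 2 * L / (r * m) * (3 * s) = 6 * L / r / s := by
          rintro s m hs rfl
          field_simp
          ring
        exact h _ _ hs0 hss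

lemma tendsto_increment_split {p C L : ℝ} (hp0 : 0 < p) (hp1 : p < 1) {d : ℕ → ℝ} (hL : 0 ≤ L)
    (hC : ∀ n, |d n| ≤ C)
    (hlip : ∀ i k : ℕ, |d k - d i| ≤ 2 * L * |(k : ℝ) - i| / (i + 1))
    (hd : ∀ n, 2 ≤ n → d n = p * binomExp p n d + (1 - p) * binomExp (1 - p) n d) :
    Tendsto (fun n : ℕ => |d ⌊p * n⌋₊ - d (n - 1 - ⌊p * n⌋₊)|) atTop (𝓝 0) := by
  have hq0 : 0 < 1 - p := by linarith
  have hharm : Tendsto (fun x : ℝ => d ⌊x⌋₊ - p * d ⌊p * x⌋₊ - (1 - p) * d ⌊(1 - p) * x⌋₊)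
      atTop (𝓝 0) := by
    have h := ((tendsto_binomExp_sub_floor hp0 hp1 hL hlip).const_mul p).add
      ((tendsto_binomExp_sub_floor hq0 (by linarith) hL hlip).const_mul (1 - p))
    rw [mul_zero, mul_zero, add_zero] at h
    refine h.congr' ?_
    filter_upwards [eventually_ge_atTop 2] with x hx
    have hn : 2 ≤ ⌊x⌋₊ := Nat.le_floor (by exact_mod_cast hx)
    rw [hd _ hn]
    ring
  have h1 := (tendsto_sub_of_asymp_harmonic hp0 hq0 (by ring) (f := fun x => d ⌊x⌋₊)
    (fun x => hC _) hharm).comp tendsto_natCast_atTop_atTop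
  have h2 : Tendsto (fun n : ℕ => d ⌊(1 - p) * n⌋₊ - d (n - 1 - ⌊p * n⌋₊)) atTop (𝓝 0) := by
    have hlim : Tendsto (fun n : ℕ => 2 * L / (1 - p) / (n : ℝ)) atTop (𝓝 0) :=
      tendsto_const_nhds.div_atTop tendsto_natCast_atTop_atTop
    refine squeeze_zero_norm' ?_ hlim
    filter_upwards [eventually_ge_atTop 1] with n hn
    obtain ⟨hjn, hj1, hjp, hjq⟩ := floor_mul_bounds hp0 hp1 hn
    have hn0 : (0 : ℝ) < n := by exact_mod_cast hn
    have ha := Nat.floor_le (by positivity : 0 ≤ (1 - p) * n)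
    have hb := Nat.lt_floor_add_one ((1 - p) * n)
    have hd1 : |(⌊(1 - p) * n⌋₊ : ℝ) - ((n - 1 - ⌊p * n⌋₊ : ℕ) : ℝ)| ≤ 1 := by
      have hj2 := Nat.lt_floor_add_one (p * n)
      have e : ((n - 1 - ⌊p * n⌋₊ : ℕ) : ℝ) = n - 1 - ⌊p * n⌋₊ := by
        rw [Nat.cast_sub (by omega), Nat.cast_sub hn, Nat.cast_one]
      rw [abs_le]
      exact ⟨by linarith, by linarith⟩
    rw [Real.norm_eq_abs, div_div]
    refine (hlip _ _).trans ?_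
    calc _ ≤ 2 * L * 1 / ((1 - p) * n) := by gcongr
      _ = _ := by rw [mul_one]
  have h3 := (h1.add h2).abs
  rw [add_zero, abs_zero] at h3
  refine h3.congr fun n => ?_
  simp only [Function.comp]
  ring_nf

lemma IsTriePairFamily.integral_recur_all {p : ℝ} (hp0 : 0 < p) (hp1 : p < 1)
    {μ : ℕ → Measure (ℕ × ℕ)} (hμ : IsTriePairFamily p μ) {φ : ℕ × ℕ → ℕ}
    (hle : ∀ x, φ x ≤ x.1 + x.2) {t : ℕ → ℕ}
    (hφ : ∀ n ω, φ (trieStep n ω) = φ (ω.2.1 ω.1) + φ (ω.2.2 (n - ω.1)) + t n) (n : ℕ) :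
    ∫ x, (φ x : ℝ) ∂μ n = (if n ≤ 1 then 0 else (t n : ℝ)) +
      binomExp p n (fun k => ∫ x, (φ x : ℝ) ∂μ k) +
      binomExp (1 - p) n (fun k => ∫ x, (φ x : ℝ) ∂μ k) := by
  have hint : ∀ n, Integrable (fun x => (φ x : ℝ)) (μ n) := by
    intro n
    have h := hμ.moments n 1
    simp only [pow_one] at h
    refine h.mono' (measurable_of_countable _).aestronglyMeasurable
      (Eventually.of_forall fun x => ?_)
    rw [Real.norm_of_nonneg (Nat.cast_nonneg _)]
    exact_mod_cast hle x
  have hφ0 : φ (0, 0) = 0 := by simpa using hle (0, 0)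
  have h0 : ∫ x, (φ x : ℝ) ∂μ 0 = 0 := by rw [hμ.init0, integral_dirac, hφ0, Nat.cast_zero]
  have h1 : ∫ x, (φ x : ℝ) ∂μ 1 = 0 := by rw [hμ.init1, integral_dirac, hφ0, Nat.cast_zero]
  match n with
  | 0 => simp [binomExp_zero, h0]
  | 1 => simp [binomExp, Finset.sum_range_succ, h0, h1]
  | n + 2 =>
    rw [if_neg (by omega)]
    exact hμ.integral_recur hp0 hp1 φ hint (n + 2) (t (n + 2)) (by omega) (hφ (n + 2))

lemma rpow_three_halves {x : ℝ} (hx : 0 < x) : x ^ ((3 : ℝ) / 2) = x * √x := by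
  rw [show (3 : ℝ) / 2 = 1 + 1 / 2 by norm_num, Real.rpow_add hx, Real.rpow_one,
    Real.sqrt_eq_rpow]

lemma tendsto_size_toll {p : ℝ} (hp0 : 0 < p) (hp1 : p < 1) {a : ℕ → ℝ}
    (ha0 : a 0 = 0) (ha1 : a 1 = 0)
    (ha : ∀ n, a n = (if n ≤ 1 then 0 else 1) + binomExp p n a + binomExp (1 - p) n a) :
    Tendsto (fun n : ℕ => binomExp p n (fun k => |1 - a n + a k + a (n - k)| ^ 3) /
      (n : ℝ) ^ ((3 : ℝ) / 2)) atTop (𝓝 0) := by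
  have ht : ∀ n : ℕ, 2 ≤ n → ((if n + 1 ≤ 1 then 0 else 1) - (if n ≤ 1 then 0 else 1) : ℝ) = 0 := by
    intro n hn
    rw [if_neg (by omega), if_neg (by omega), sub_self]
  obtain ⟨C, hC, hdd⟩ := exists_second_diff_bound hp0 hp1 ha
    fun n hn => (ht (n + 1) (by omega)).trans (ht n hn).symm
  have hdrec : ∀ n, a (n + 1) - a n = ((if n + 1 ≤ 1 then 0 else 1) - (if n ≤ 1 then 0 else 1)) +
      p * binomExp p n (fun k => a (k + 1) - a k) +
      (1 - p) * binomExp (1 - p) n (fun k => a (k + 1) - a k) := by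
    simpa only [one_mul] using binom_recur_diff (p := p) (c₁ := 1) (c₂ := 1) (a := a)
      (fun n => by rw [one_mul, one_mul]; exact ha n)
  obtain ⟨B, hB, hdB⟩ := exists_diff_bound hp0 hp1 (d := fun n => a (n + 1) - a n)
    (by simp [ha0, ha1]) ht hdrec
  set L := C + 2 * B with hLdef
  have hL : 0 ≤ L := by positivity
  have hlip : ∀ i k : ℕ, |(a (k + 1) - a k) - (a (i + 1) - a i)| ≤
      2 * L * |(k : ℝ) - i| / (i + 1) := fun i k =>
    abs_sub_le_of_diff_le_of_osc (d := fun n => a (n + 1) - a n) hC hdd (by linarith)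
      ((abs_sub _ _).trans (by linarith [hdB i, hdB k]))
  have hε := tendsto_increment_split hp0 hp1 hL hdB hlip fun n hn => by
    have h := hdrec n
    rwa [ht n hn, zero_add] at h
  have hlim : Tendsto (fun n : ℕ => 576 *
      |(a (⌊p * n⌋₊ + 1) - a ⌊p * n⌋₊) - (a (n - 1 - ⌊p * n⌋₊ + 1) - a (n - 1 - ⌊p * n⌋₊))| ^ 3 +
      1024 * (2 * L / (p * (1 - p))) ^ 3 / √(n : ℝ)) atTop (𝓝 0) := by
    have h1 := (hε.pow 3).const_mul 576
    have h2 : Tendsto (fun n : ℕ => 1024 * (2 * L / (p * (1 - p))) ^ 3 / √(n : ℝ)) atTop (𝓝 0) :=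
      tendsto_const_nhds.div_atTop (Real.tendsto_sqrt_atTop.comp tendsto_natCast_atTop_atTop)
    simpa using h1.add h2
  have hnonneg : ∀ n : ℕ, 0 ≤ binomExp p n (fun k => |1 - a n + a k + a (n - k)| ^ 3) := by
    intro n
    rw [← binomExp_const p n 0]
    exact binomExp_mono hp0 hp1 fun k _ => by positivity
  refine squeeze_zero' (Eventually.of_forall fun n => div_nonneg (hnonneg n) (by positivity)) ?_ hlim
  filter_upwards [eventually_ge_atTop 2] with n hn
  have hn0 : (0 : ℝ) < n := by positivity
  have h := binomExp_toll_pow_three_le hp0 hp1 (T := 1) (n := n) (by omega) hL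
    (by simpa [show ¬ n ≤ 1 by omega] using ha n) (fun i k _ _ => hlip i k) le_rfl
  have hs0 : 0 < √(n : ℝ) := Real.sqrt_pos.2 hn0
  rw [rpow_three_halves hn0, div_le_iff₀ (by positivity)]
  refine h.trans (le_of_eq ?_)
  field_simp

lemma tendsto_log_pow_div_sqrt :
    Tendsto (fun n : ℕ => Real.log n ^ 3 / √(n : ℝ)) atTop (𝓝 0) := by
  have h := (isLittleO_log_rpow_rpow_atTop 3 (by norm_num : (0 : ℝ) < 1 / 2)).tendsto_div_nhds_zero
  refine (h.comp tendsto_natCast_atTop_atTop).congr fun n => ?_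
  simp only [Function.comp, Real.sqrt_eq_rpow]
  norm_cast

lemma tendsto_path_toll {p : ℝ} (hp0 : 0 < p) (hp1 : p < 1) {a : ℕ → ℝ}
    (ha : ∀ n, a n = (if n ≤ 1 then 0 else (n : ℝ)) + binomExp p n a + binomExp (1 - p) n a) :
    Tendsto (fun n : ℕ => binomExp p n (fun k => |n - a n + a k + a (n - k)| ^ 3) /
      ((n : ℝ) * Real.log n) ^ ((3 : ℝ) / 2)) atTop (𝓝 0) := by
  have hq0 : 0 < 1 - p := by linarith
  obtain ⟨C, hC, hdd⟩ := exists_second_diff_bound hp0 hp1 ha fun n hn => by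
    rw [if_neg (by omega), if_neg (by omega), if_neg (by omega)]
    push_cast; ring
  have hosc0 : ∀ n k : ℕ, 1 ≤ n → k ≤ n →
      |(a (k + 1) - a k) - (a 1 - a 0)| ≤ C * (1 + Real.log n) := by
    intro n k hn hk
    have h1 : ∀ k : ℕ, |(a (k + 1) - a k) - (a 1 - a 0)| ≤ C * (harmonic k : ℝ) := by
      intro k
      induction k with
      | zero => simp
      | succ k ih =>
        have h2 := abs_add_le ((a (k + 2) - a (k + 1)) - (a (k + 1) - a k))
          ((a (k + 1) - a k) - (a 1 - a 0))
        rw [sub_add_sub_cancel] at h2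
        rw [harmonic_succ]
        push_cast
        have := hdd k
        rw [div_eq_mul_inv] at this
        linarith
    refine (h1 k).trans (mul_le_mul_of_nonneg_left ?_ hC)
    rcases Nat.eq_zero_or_pos k with rfl | hk0
    · have := Real.log_nonneg (by exact_mod_cast hn : (1 : ℝ) ≤ n)
      simp; linarith
    · have h2 := harmonic_le_one_add_log k
      have h3 : Real.log k ≤ Real.log n :=
        Real.log_le_log (by exact_mod_cast hk0) (by exact_mod_cast hk)
      linarith
  set E := C / (p * (1 - p)) with hE
  have hE0 : 0 ≤ E := by positivity
  have hε : ∀ n : ℕ, 1 ≤ n → |(a (⌊p * n⌋₊ + 1) - a ⌊p * n⌋₊) -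
      (a (n - 1 - ⌊p * n⌋₊ + 1) - a (n - 1 - ⌊p * n⌋₊))| ≤ E := by
    intro n hn
    have hn0 : (0 : ℝ) < n := by exact_mod_cast hn
    obtain ⟨hjn, hj1, hjp, hjq⟩ := floor_mul_bounds hp0 hp1 hn
    set j := ⌊p * n⌋₊
    have key : ∀ i k : ℕ, i ≤ k → k ≤ n → p * (1 - p) * n ≤ (i : ℝ) + 1 →
        |(a (k + 1) - a k) - (a (i + 1) - a i)| ≤ E := by
      intro i k hik hkn hi
      have h1 := abs_sub_le_of_diff_le (d := fun n => a (n + 1) - a n) hC hdd hik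
      have hik' : (i : ℝ) ≤ k := by exact_mod_cast hik
      have hkn' : (k : ℝ) ≤ n := by exact_mod_cast hkn
      have hpr : 0 < p * (1 - p) := by positivity
      refine h1.trans ?_
      calc C * ((k : ℝ) - i) / (i + 1) ≤ C * n / (p * (1 - p) * n) := by
            have : (k : ℝ) - i ≤ n := by linarith [Nat.cast_nonneg (α := ℝ) i]
            gcongr
        _ = E := by rw [hE]; field_simp
    rcases le_total j (n - 1 - j) with h | h
    · rw [abs_sub_comm]
      exact key _ _ h (by omega) (by nlinarith [mul_pos hp0 hn0])
    · exact key _ _ h hjn.le (by nlinarith [mul_pos hq0 hn0])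
  set M := 2 * (2 * C) / (p * (1 - p)) with hM
  have hM0 : 0 ≤ M := by positivity
  have hlim : Tendsto (fun n : ℕ => 576 * E ^ 3 / Real.log n +
      8192 * M ^ 3 * (Real.log n ^ 3 / √(n : ℝ))) atTop (𝓝 0) := by
    have h1 : Tendsto (fun n : ℕ => 576 * E ^ 3 / Real.log n) atTop (𝓝 0) :=
      tendsto_const_nhds.div_atTop (Real.tendsto_log_atTop.comp tendsto_natCast_atTop_atTop)
    simpa using h1.add (tendsto_log_pow_div_sqrt.const_mul (8192 * M ^ 3))
  have hnonneg : ∀ n : ℕ, 0 ≤ binomExp p n (fun k => |n - a n + a k + a (n - k)| ^ 3) := by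
    intro n
    rw [← binomExp_const p n 0]
    exact binomExp_mono hp0 hp1 fun k _ => by positivity
  have hlog : ∀ᶠ n : ℕ in atTop, 1 ≤ Real.log n :=
    (Real.tendsto_log_atTop.comp tendsto_natCast_atTop_atTop).eventually_ge_atTop 1
  refine squeeze_zero' ?_ ?_ hlim
  · filter_upwards [hlog] with n hl
    have : 0 ≤ (n : ℝ) * Real.log n := by positivity
    exact div_nonneg (hnonneg n) (Real.rpow_nonneg this _)
  filter_upwards [eventually_ge_atTop 2, hlog] with n hn hl
  have hn0 : (0 : ℝ) < n := by positivity
  set l := Real.log n with hldef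
  have hL : 0 ≤ 2 * C * (1 + l) := by positivity
  have hlip : ∀ i k : ℕ, i ≤ n → k ≤ n → |(a (k + 1) - a k) - (a (i + 1) - a i)| ≤
      2 * (2 * C * (1 + l)) * |(k : ℝ) - i| / (i + 1) := by
    intro i k hi hk
    refine abs_sub_le_of_diff_le_of_osc (d := fun n => a (n + 1) - a n) hC hdd (by nlinarith) ?_
    have h1 := hosc0 n i (by omega) hi
    have h2 := hosc0 n k (by omega) hk
    have h3 := abs_sub ((a (k + 1) - a k) - (a 1 - a 0)) ((a (i + 1) - a i) - (a 1 - a 0))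
    rw [sub_sub_sub_cancel_right] at h3
    linarith
  have h := binomExp_toll_pow_three_le hp0 hp1 (T := n) (n := n) (by omega) hL
    (by simpa [show ¬ n ≤ 1 by omega] using ha n) hlip (hε n (by omega))
  have hs0 : 0 < √(n : ℝ) := Real.sqrt_pos.2 hn0
  have hss : √(n : ℝ) * √(n : ℝ) = n := Real.mul_self_sqrt hn0.le
  have hsl : 1 ≤ √l := Real.one_le_sqrt.2 hl
  have hl0 : 0 < l := by linarith
  rw [rpow_three_halves (by positivity), div_le_iff₀ (by positivity), Real.sqrt_mul hn0.le]
  have h1 : 2 * (2 * C * (1 + l)) / (p * (1 - p)) ≤ M * (2 * l) := by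
    calc 2 * (2 * C * (1 + l)) / (p * (1 - p)) = M * (1 + l) := by rw [hM]; ring
      _ ≤ M * (2 * l) := by gcongr; linarith
  calc _ ≤ _ := h
    _ ≤ 576 * E ^ 3 * (n * √n) + 1024 * (M * (2 * l)) ^ 3 * n := by gcongr
    _ = (576 * E ^ 3 / l + 8192 * M ^ 3 * (l ^ 3 / √n)) * (n * √n * l) -
        8192 * M ^ 3 * l ^ 3 * n * (l - 1) := by field_simp; ring
    _ ≤ (576 * E ^ 3 / l + 8192 * M ^ 3 * (l ^ 3 / √n)) * (n * √n * l) := by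
        have : 0 ≤ 8192 * M ^ 3 * l ^ 3 * n * (l - 1) := mul_nonneg (by positivity) (by linarith)
        linarith
    _ ≤ (576 * E ^ 3 / l + 8192 * M ^ 3 * (l ^ 3 / √n)) * (n * √n * l * √l) :=
        mul_le_mul_of_nonneg_left (le_mul_of_one_le_right (by positivity) hsl) (by positivity)
    _ = _ := by ring

/-- the `L₃` conditions for the toll terms in the contraction method. -/
theorem stmt17 (p : ℝ) (hp0 : 0 < p) (hp1 : p < 1) (hp : p ≠ 1 / 2)
    (μ : ℕ → Measure (ℕ × ℕ)) (hμ : IsTriePairFamily p μ) :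
    Tendsto (fun n : ℕ =>
        (∫ k, |1 - eS μ n + eS μ k + eS μ (n - k)| ^ 3 ∂ binomialMeasure n p) /
          (n : ℝ) ^ ((3 : ℝ) / 2)) atTop (𝓝 0) ∧
    Tendsto (fun n : ℕ =>
        (∫ k, |(n : ℝ) - eK μ n + eK μ k + eK μ (n - k)| ^ 3 ∂ binomialMeasure n p) /
          ((n : ℝ) * Real.log n) ^ ((3 : ℝ) / 2)) atTop (𝓝 0) := by

  constructor
  · simp only [integral_binomialMeasure hp0 hp1]
    exact tendsto_size_toll hp0 hp1 (by simp [eS, hμ.init0]) (by simp [eS, hμ.init1]) fun n => by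
      have h := hμ.integral_recur_all hp0 hp1 (φ := Prod.fst) (t := fun _ => 1)
        (fun x => Nat.le_add_right _ _) (fun n ω => rfl) n
      simp only [Nat.cast_one] at h
      exact h
  · simp only [integral_binomialMeasure hp0 hp1]
    exact tendsto_path_toll hp0 hp1 fun n =>
      hμ.integral_recur_all hp0 hp1 (φ := Prod.snd) (t := fun n => n)
        (fun x => Nat.le_add_left _ _) (fun n ω => rfl) n
end
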